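/- arXiv:2310.03516 — 2 statements merged into one kernel-verified Lean document; each statement's English description precedes it below -/
import Mathlib

section
/- Let p ∈ ℝ and let μ = Σ_{i=1}^{2m} a_i δ_{e_i} be an even discrete measure on 𝕊^n, i.e. m ≥ 1, the points e_1,…,e_{2m} ∈ 𝕊^n are pairwise distinct with e_{m+i} = −e_i for 1 ≤ i ≤ m, and the weights satisfy a_i = a_{m+i} > 0 for 1 ≤ i ≤ m. Then there exist an origin-symmetric h-convex polytope P in ℍ^{n+1} containing O in its interior, whose facets have precisely the horospherical normals e_1,…,e_{2m}, and a constant λ > 0, such that a_i = λ · e^{−p·u(P,e_i)} · S(P,e_i) for every i = 1,…,2m (that is, μ is a multiple of the horospherical p-surface area measure S_p(P,·) = Σ_i e^{−p u(P,e_i)} S(P,e_i) δ_{e_i} of P). -/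
noncomputable section

open Real MeasureTheory Filter Topology Set
open scoped ENNReal symmDiff

namespace Horo

/-- The Lorentzian inner product on ℝ^{n+2}:
`X·Y = Σ_{i=1}^{n+1} x_i y_i − x_{n+2} y_{n+2}`. -/
def lprod (n : ℕ) (X Y : Fin (n + 2) → ℝ) : ℝ :=
  (∑ i : Fin (n + 1), X i.castSucc * Y i.castSucc) - X (Fin.last (n + 1)) * Y (Fin.last (n + 1))

/-- The hyperboloid model ℍ^{n+1} of hyperbolic space. -/
def Hyp (n : ℕ) : Set (Fin (n + 2) → ℝ) :=
  {X | lprod n X X = -1 ∧ 0 < X (Fin.last (n + 1))}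

/-- The origin O = (0,…,0,1) of hyperbolic space. -/
def origin (n : ℕ) : Fin (n + 2) → ℝ := Fin.snoc (fun _ => 0) 1

/-- The unit sphere 𝕊^n ⊂ ℝ^{n+1}. -/
def sph (n : ℕ) : Set (Fin (n + 1) → ℝ) := {e | ∑ i, e i ^ 2 = 1}

/-- The null vector (e,1) ∈ ℝ^{n+2} associated with e ∈ 𝕊^n. -/
def dir {n : ℕ} (e : Fin (n + 1) → ℝ) : Fin (n + 2) → ℝ := Fin.snoc e 1

/-- The geodesic distance d(X,Y) = arcosh(−X·Y) on the hyperboloid. -/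
def dH (n : ℕ) (X Y : Fin (n + 2) → ℝ) : ℝ :=
  Real.log (-(lprod n X Y) + Real.sqrt ((lprod n X Y) ^ 2 - 1))

/-- The horosphere H_e(s) = {X ∈ ℍ^{n+1} : X·(e,1) = −e^s}. -/
def horoSphere (n : ℕ) (e : Fin (n + 1) → ℝ) (s : ℝ) : Set (Fin (n + 2) → ℝ) :=
  {X ∈ Hyp n | lprod n X (dir e) = -Real.exp s}

/-- The open horo-ball B_e(s) = {X ∈ ℍ^{n+1} : 0 > X·(e,1) > −e^s}. -/
def horoBall (n : ℕ) (e : Fin (n + 1) → ℝ) (s : ℝ) : Set (Fin (n + 2) → ℝ) :=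
  {X ∈ Hyp n | 0 > lprod n X (dir e) ∧ lprod n X (dir e) > -Real.exp s}

/-- The closed horo-ball B̄_e(s) = {X ∈ ℍ^{n+1} : 0 > X·(e,1) ≥ −e^s}. -/
def horoBallCl (n : ℕ) (e : Fin (n + 1) → ℝ) (s : ℝ) : Set (Fin (n + 2) → ℝ) :=
  {X ∈ Hyp n | 0 > lprod n X (dir e) ∧ lprod n X (dir e) ≥ -Real.exp s}

/-- A set Ω ⊂ ℍ^{n+1} is horospherically convex (h-convex) if it is closed and every
relative boundary point of Ω admits a supporting horo-ball. -/
def IsHConvex (n : ℕ) (Ω : Set (Fin (n + 2) → ℝ)) : Prop :=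
  Ω ⊆ Hyp n ∧ IsClosed Ω ∧
    ∀ X ∈ Ω ∩ closure (Hyp n \ Ω),
      ∃ e ∈ sph n, ∃ s : ℝ, Ω ⊆ horoBallCl n e s ∧ X ∈ horoSphere n e s

/-- The interior of a subset of the hyperboloid, relative to the hyperboloid. -/
def relInt (n : ℕ) (K : Set (Fin (n + 2) → ℝ)) : Set (Fin (n + 2) → ℝ) :=
  {X ∈ Hyp n | ∃ ε > 0, ∀ Y ∈ Hyp n, dH n X Y < ε → Y ∈ K}

/-- A h-convex body: a compact h-convex set with nonempty (relative) interior. -/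
def IsHConvexBody (n : ℕ) (K : Set (Fin (n + 2) → ℝ)) : Prop :=
  IsHConvex n K ∧ IsCompact K ∧ (relInt n K).Nonempty

/-- A h-convex polytope: a h-convex body which is a finite intersection of closed
horo-balls. -/
def IsHPolytope (n : ℕ) (P : Set (Fin (n + 2) → ℝ)) : Prop :=
  IsHConvexBody n P ∧ ∃ m : ℕ, 2 ≤ m ∧ ∃ (e : Fin m → (Fin (n + 1) → ℝ)) (u : Fin m → ℝ),
    (∀ i, e i ∈ sph n) ∧ P = ⋂ i, horoBallCl n (e i) (u i)

/-- The horospherical support function u(K,e) = sup{log(−X·(e,1)) : X ∈ K}. -/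
def suppFn (n : ℕ) (K : Set (Fin (n + 2) → ℝ)) (e : Fin (n + 1) → ℝ) : ℝ :=
  sSup ((fun X => Real.log (-(lprod n X (dir e)))) '' K)

/-- The outer parallel set K^ε = {X ∈ ℍ^{n+1} : d(K,X) ≤ ε}. -/
def outPar (n : ℕ) (K : Set (Fin (n + 2) → ℝ)) (ε : ℝ) : Set (Fin (n + 2) → ℝ) :=
  {X ∈ Hyp n | ∃ Y ∈ K, dH n Y X ≤ ε}

/-- The Hausdorff distance d_H(K,L) = inf{ε ≥ 0 : K ⊆ L^ε and L ⊆ K^ε}. -/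
def dHaus (n : ℕ) (K L : Set (Fin (n + 2) → ℝ)) : ℝ :=
  sInf {ε : ℝ | 0 ≤ ε ∧ K ⊆ outPar n L ε ∧ L ⊆ outPar n K ε}

/-- The point (sinh r · θ, cosh r) ∈ ℍ^{n+1} at distance r from O in direction θ. -/
def rpt (n : ℕ) (θ : Fin (n + 1) → ℝ) (r : ℝ) : Fin (n + 2) → ℝ :=
  Fin.snoc (fun i => Real.sinh r * θ i) (Real.cosh r)

/-- The radial function ρ(K,θ) = max{λ ≥ 0 : (sinh λ · θ, cosh λ) ∈ K}. -/
def radFn (n : ℕ) (K : Set (Fin (n + 2) → ℝ)) (θ : Fin (n + 1) → ℝ) : ℝ :=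
  sSup {r : ℝ | 0 ≤ r ∧ rpt n θ r ∈ K}

/-- R(K) = max_θ ρ(K,θ). -/
def Rmax (n : ℕ) (K : Set (Fin (n + 2) → ℝ)) : ℝ := sSup (radFn n K '' sph n)

/-- r(K) = min_θ ρ(K,θ). -/
def rmin (n : ℕ) (K : Set (Fin (n + 2) → ℝ)) : ℝ := sInf (radFn n K '' sph n)

/-- The point reflection (x_1,…,x_{n+1},x_{n+2}) ↦ (−x_1,…,−x_{n+1},x_{n+2}) about O. -/
def symMap (n : ℕ) (X : Fin (n + 2) → ℝ) : Fin (n + 2) → ℝ :=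
  fun i => if i = Fin.last (n + 1) then X i else -X i

/-- The hyperbolic (Riemannian) volume of a subset of the hyperboloid, computed via the
graph parametrization x ↦ (x, √(1+|x|²)), whose volume density is 1/√(1+|x|²). -/
def hypVol (n : ℕ) (K : Set (Fin (n + 2) → ℝ)) : ℝ :=
  ∫ x : Fin (n + 1) → ℝ,
    Set.indicator {y : Fin (n + 1) → ℝ | Fin.snoc y (Real.sqrt (1 + ∑ i, y i ^ 2)) ∈ K}
      (fun y => 1 / Real.sqrt (1 + ∑ i, y i ^ 2)) x

/-- The distance from a point X to a set P. -/
def distTo (n : ℕ) (P : Set (Fin (n + 2) → ℝ)) (X : Fin (n + 2) → ℝ) : ℝ :=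
  sInf ((fun Y => dH n Y X) '' P)

/-- The facet F(P,e) = P ∩ H_e(u(P,e)). -/
def facet (n : ℕ) (P : Set (Fin (n + 2) → ℝ)) (e : Fin (n + 1) → ℝ) :
    Set (Fin (n + 2) → ℝ) :=
  P ∩ horoSphere n e (suppFn n P e)

/-- The relative interior of the facet F(P,e) inside the horosphere H_e(u(P,e)). -/
def facetRelInt (n : ℕ) (P : Set (Fin (n + 2) → ℝ)) (e : Fin (n + 1) → ℝ) :
    Set (Fin (n + 2) → ℝ) :=
  {Y ∈ facet n P e | ∃ δ > 0, ∀ Z ∈ horoSphere n e (suppFn n P e),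
    dH n Y Z < δ → Z ∈ facet n P e}

/-- The collar 𝒫_t(P, F̊(P,e)): points at positive distance ≤ t from P whose nearest
point in P lies in the relative interior of the facet F(P,e). -/
def collar (n : ℕ) (P : Set (Fin (n + 2) → ℝ)) (e : Fin (n + 1) → ℝ) (t : ℝ) :
    Set (Fin (n + 2) → ℝ) :=
  {X ∈ Hyp n | 0 < distTo n P X ∧ distTo n P X ≤ t ∧
    ∃ Y ∈ facetRelInt n P e, ∀ Z ∈ P, dH n Y X ≤ dH n Z X}

/-- The diameter of a set with respect to a distance function, in ℝ≥0∞. -/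
def ediamWith {α : Type*} (d : α → α → ℝ) (U : Set α) : ℝ≥0∞ :=
  ⨆ (x ∈ U) (y ∈ U), ENNReal.ofReal (d x y)

/-- The (unnormalized) s-dimensional Hausdorff measure associated with a distance
function d, via the Carathéodory construction. -/
def hMeasWith {α : Type*} (d : α → α → ℝ) (s : ℕ) (A : Set α) : ℝ≥0∞ :=
  ⨆ (δ : ℝ) (_ : 0 < δ),
    ⨅ (U : ℕ → Set α) (_ : A ⊆ ⋃ i, U i) (_ : ∀ i, ediamWith d (U i) ≤ ENNReal.ofReal δ),
      ∑' i, ediamWith d (U i) ^ s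

/-- ω_n, the volume of the unit ball in ℝ^n. -/
def unitBallVol (n : ℕ) : ℝ :=
  (volume (Metric.ball (0 : EuclideanSpace ℝ (Fin n)) 1)).toReal

/-- S(P,e): the n-dimensional area of the facet F(P,e), i.e. the normalized
n-dimensional Hausdorff measure of F(P,e) with respect to the hyperbolic distance. -/
def areaFacet (n : ℕ) (P : Set (Fin (n + 2) → ℝ)) (e : Fin (n + 1) → ℝ) : ℝ :=
  (ENNReal.ofReal (unitBallVol n / 2 ^ n) * hMeasWith (dH n) n (facet n P e)).toReal

section Chart

variable {E F : Type*} [NormedAddCommGroup E] [InnerProductSpace ℝ E]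
  [NormedAddCommGroup F] [InnerProductSpace ℝ F]

/-- The last coordinate of the point of the hyperboloid lying over `x`. -/
def height (x : E) : ℝ := √(1 + ‖x‖ ^ 2)

/-- Minus the Lorentzian product of the point of the hyperboloid over `x` with `(f, 1)`. -/
def horo (f x : E) : ℝ := height x - inner ℝ f x

/-- The horospherical parametrization of the hyperboloid associated with a unit vector `f` and an
isometry `A` onto its orthogonal complement. -/
def chart (f : E) (A : F →ₗᵢ[ℝ] E) (s : ℝ) (z : F) : E :=
  (((1 + ‖z‖ ^ 2) * exp (-s) - exp s) / 2) • f + A z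

omit [InnerProductSpace ℝ E] in
lemma height_pos (x : E) : 0 < height x := by unfold height; positivity

omit [InnerProductSpace ℝ E] in
lemma height_sq (x : E) : height x ^ 2 = 1 + ‖x‖ ^ 2 := Real.sq_sqrt (by positivity)

omit [InnerProductSpace ℝ E] in
lemma one_le_height (x : E) : 1 ≤ height x := by
  nlinarith [height_sq x, height_pos x, sq_nonneg ‖x‖]

omit [InnerProductSpace ℝ E] in
lemma norm_lt_height (x : E) : ‖x‖ < height x :=
  lt_of_pow_lt_pow_left₀ 2 (height_pos x).le (by rw [height_sq]; linarith)

omit [InnerProductSpace ℝ E] in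
@[fun_prop]
lemma continuous_height : Continuous (height : E → ℝ) := by unfold height; fun_prop

@[fun_prop]
lemma continuous_horo (f : E) : Continuous (horo f) := by unfold horo; fun_prop

lemma horo_pos {f : E} (hf : ‖f‖ = 1) (x : E) : 0 < horo f x := by
  have h1 := real_inner_le_norm f x
  have h2 := norm_lt_height x
  rw [hf, one_mul] at h1
  unfold horo; linarith

lemma horo_le {f : E} (hf : ‖f‖ = 1) (x : E) : horo f x ≤ height x + ‖x‖ := by
  have h1 := neg_le_of_abs_le (abs_real_inner_le_norm f x)
  rw [hf, one_mul] at h1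
  unfold horo; linarith

/-- A unit vector together with an isometry onto its orthogonal complement which gives rise to a
volume preserving orthogonal splitting of the space. -/
structure IsFrame [MeasureSpace E] [MeasureSpace F] (f : E) (A : F →ₗᵢ[ℝ] E) : Prop where
  norm_eq : ‖f‖ = 1
  inner_eq : ∀ z, inner ℝ f (A z) = 0
  surj : ∀ x, ∃ z, x = inner ℝ f x • f + A z
  measurePreserving : MeasurePreserving (fun q : ℝ × F => q.1 • f + A q.2)
    ((volume : Measure ℝ).prod (volume : Measure F)) (volume : Measure E)

variable {f : E} {A : F →ₗᵢ[ℝ] E}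

lemma height_smul_add (hf : ‖f‖ = 1) (hA : ∀ z, inner ℝ f (A z) = 0) (t : ℝ) (z : F) :
    height (t • f + A z) = √(1 + (t ^ 2 + ‖z‖ ^ 2)) := by
  unfold height
  rw [norm_add_sq_real, norm_smul, real_inner_smul_left, hA, hf, A.norm_map]
  simp

lemma height_chart (hf : ‖f‖ = 1) (hA : ∀ z, inner ℝ f (A z) = 0) (s : ℝ) (z : F) :
    height (chart f A s z) = ((1 + ‖z‖ ^ 2) * exp (-s) + exp s) / 2 := by
  rw [chart, height_smul_add hf hA, Real.sqrt_eq_iff_eq_sq (by positivity) (by positivity)]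
  have : exp (-s) * exp s = 1 := by rw [← exp_add]; simp
  linear_combination (-(1 + ‖z‖ ^ 2)) * this

lemma horo_chart (hf : ‖f‖ = 1) (hA : ∀ z, inner ℝ f (A z) = 0) (g : E) (s : ℝ) (z : F) :
    horo g (chart f A s z) = (1 - inner ℝ g f) / 2 * exp (-s) * (1 + ‖z‖ ^ 2)
      + (1 + inner ℝ g f) / 2 * exp s - inner ℝ g (A z) := by
  rw [horo, height_chart hf hA, chart, inner_add_right, real_inner_smul_right]
  ring

lemma horo_chart_self (hf : ‖f‖ = 1) (hA : ∀ z, inner ℝ f (A z) = 0) (s : ℝ) (z : F) :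
    horo f (chart f A s z) = exp s := by
  rw [horo_chart hf hA, hA, real_inner_self_eq_norm_sq, hf]; ring

lemma horo_neg_chart (hf : ‖f‖ = 1) (hA : ∀ z, inner ℝ f (A z) = 0) (s : ℝ) (z : F) :
    horo (-f) (chart f A s z) = exp (-s) * (1 + ‖z‖ ^ 2) := by
  rw [horo_chart hf hA, inner_neg_left, inner_neg_left, hA, real_inner_self_eq_norm_sq, hf]; ring

lemma continuous_chart_uncurry : Continuous (fun q : ℝ × F => chart f A q.1 q.2) := by
  unfold chart; fun_prop

lemma continuous_chart (s : ℝ) : Continuous (chart f A s) := by unfold chart; fun_prop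

lemma chart_neg (s : ℝ) (z : F) :
    chart (-f) (A.comp (LinearIsometryEquiv.neg ℝ : F ≃ₗᵢ[ℝ] F).toLinearIsometry) s z
      = -chart f A s z := by
  simp [chart, add_comm]

lemma horo_neg_neg (g x : E) : horo (-g) (-x) = horo g x := by
  simp [horo, height]

lemma IsFrame.neg [MeasureSpace E] [MeasureSpace F] [BorelSpace E] [BorelSpace F]
    (h : IsFrame f A) (hE : MeasurePreserving (fun x : E => -x)) :
    IsFrame (-f) (A.comp (LinearIsometryEquiv.neg ℝ : F ≃ₗᵢ[ℝ] F).toLinearIsometry) where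
  norm_eq := by simp [h.norm_eq]
  inner_eq z := by simp [h.inner_eq]
  surj x := by
    obtain ⟨z, hz⟩ := h.surj x
    exact ⟨-z, by simpa using hz⟩
  measurePreserving := by
    have := hE.comp h.measurePreserving
    convert this using 1
    ext q
    simp [add_comm]

lemma exists_chart_eq [MeasureSpace E] [MeasureSpace F] (h : IsFrame f A) {s : ℝ} {x : E}
    (hx : horo f x = exp s) : ∃ z, chart f A s z = x := by
  obtain ⟨z, hz⟩ := h.surj x
  refine ⟨z, ?_⟩
  set t := inner ℝ f x with ht
  have h1 : height x = √(1 + (t ^ 2 + ‖z‖ ^ 2)) := by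
    conv_lhs => rw [hz]
    exact height_smul_add h.norm_eq h.inner_eq _ _
  have h2 : height x ^ 2 = 1 + (t ^ 2 + ‖z‖ ^ 2) := by rw [h1, Real.sq_sqrt (by positivity)]
  have h3 : height x = t + exp s := by rw [← hx, horo, ← ht]; ring
  have h4 : exp (-s) * exp s = 1 := by rw [← exp_add]; simp
  have h5 : ((1 + ‖z‖ ^ 2) * exp (-s) - exp s) / 2 = t := by
    have : 1 + ‖z‖ ^ 2 = 2 * t * exp s + exp s ^ 2 := by rw [h3] at h2; linarith
    rw [this]
    linear_combination (t + exp s / 2) * h4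
  rw [chart, h5, ← hz]

variable [MeasureSpace E] [BorelSpace E] [MeasureSpace F] [BorelSpace F]

/-- The hyperbolic volume in the graph parametrization of the hyperboloid. -/
def hvol (E : Type*) [NormedAddCommGroup E] [InnerProductSpace ℝ E] [MeasureSpace E] :
    Measure E :=
  (volume : Measure E).withDensity (fun x => ENNReal.ofReal (1 / height x))

/-- Slicing the hyperbolic volume by the horospheres with a common centre. -/
lemma hvol_eq_lintegral [SecondCountableTopology F] [SFinite (volume : Measure F)]
    (h : IsFrame f A) {B : Set E} (hB : MeasurableSet B) :
    hvol E B = ∫⁻ s : ℝ, volume (chart f A s ⁻¹' B) := by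
  have hmeas : Measurable (fun x : E => ENNReal.ofReal (1 / height x)) := by
    have : Measurable (height : E → ℝ) := continuous_height.measurable
    fun_prop
  set G : E → ℝ≥0∞ := B.indicator (fun x => ENNReal.ofReal (1 / height x)) with hG
  have hGm : Measurable G := hmeas.indicator hB
  have hsub : ∀ z : F, ∫⁻ t : ℝ, G (t • f + A z)
      = ∫⁻ s : ℝ, B.indicator 1 (chart f A s z) := by
    intro z
    set τ : ℝ → ℝ := fun s => ((1 + ‖z‖ ^ 2) * exp (-s) - exp s) / 2 with hτ
    have hτd : ∀ s, HasDerivAt τ (-(((1 + ‖z‖ ^ 2) * exp (-s) + exp s) / 2)) s := by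
      intro s
      have h1 : HasDerivAt (fun s => exp (-s)) (-exp (-s)) s := by
        simpa using (hasDerivAt_neg s).exp
      exact (((h1.const_mul (1 + ‖z‖ ^ 2)).sub (Real.hasDerivAt_exp s)).div_const 2).congr_deriv
        (by ring)
    have hanti : StrictAnti τ := by
      apply strictAnti_of_deriv_neg
      intro s
      rw [(hτd s).deriv]
      have : 0 < ((1 + ‖z‖ ^ 2) * exp (-s) + exp s) / 2 := by positivity
      linarith
    have himg : τ '' univ = univ := by
      rw [image_univ, range_eq_univ]
      intro t
      set w := √(1 + (t ^ 2 + ‖z‖ ^ 2)) with hw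
      have hw2 : w ^ 2 = 1 + (t ^ 2 + ‖z‖ ^ 2) := Real.sq_sqrt (by positivity)
      have hwt : 0 < w - t := by
        have : |t| < w := abs_lt_of_sq_lt_sq (by rw [hw2]; nlinarith [sq_nonneg ‖z‖])
          (Real.sqrt_nonneg _)
        linarith [le_abs_self t]
      refine ⟨Real.log (w - t), ?_⟩
      simp only [hτ]
      rw [exp_neg, exp_log hwt]
      field_simp
      nlinarith
    have key := lintegral_image_eq_lintegral_abs_deriv_mul MeasurableSet.univ
      (fun s _ => (hτd s).hasDerivWithinAt) hanti.injective.injOn (fun t => G (t • f + A z))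
    rw [himg] at key
    simp only [Measure.restrict_univ] at key
    rw [key]
    refine lintegral_congr fun s => ?_
    have hc : τ s • f + A z = chart f A s z := rfl
    rw [hc, hG]
    by_cases hx : chart f A s z ∈ B
    · rw [indicator_of_mem hx, indicator_of_mem hx, height_chart h.norm_eq h.inner_eq, abs_neg,
        abs_of_pos (by positivity), ← ENNReal.ofReal_mul (by positivity), mul_one_div_cancel]
      · simp
      · positivity
    · rw [indicator_of_notMem hx, indicator_of_notMem hx, mul_zero]
  have hcm : Measurable (fun q : ℝ × F => chart f A q.1 q.2) :=
    continuous_chart_uncurry.measurable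
  calc hvol E B = ∫⁻ x, G x := by
        rw [hvol, withDensity_apply _ hB, ← lintegral_indicator hB]
    _ = ∫⁻ q : ℝ × F, G (q.1 • f + A q.2) ∂((volume : Measure ℝ).prod volume) := by
        rw [← h.measurePreserving.lintegral_comp hGm]
    _ = ∫⁻ z : F, ∫⁻ t : ℝ, G (t • f + A z) :=
        lintegral_prod_symm' _ (hGm.comp h.measurePreserving.measurable)
    _ = ∫⁻ z : F, ∫⁻ s : ℝ, B.indicator 1 (chart f A s z) := lintegral_congr hsub
    _ = ∫⁻ s : ℝ, ∫⁻ z : F, B.indicator 1 (chart f A s z) := by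
        rw [lintegral_lintegral_swap]
        exact ((measurable_one.indicator hB).comp (hcm.comp measurable_swap)).aemeasurable
    _ = ∫⁻ s : ℝ, volume (chart f A s ⁻¹' B) := by
        refine lintegral_congr fun s => ?_
        rw [← lintegral_indicator_one ((continuous_chart s).measurable hB)]
        rfl

omit [MeasureSpace E] [BorelSpace E] in
/-- Two distinct horospheres meet in a null set of either of them. -/
lemma volume_horo_chart_eq [FiniteDimensional ℝ F] [FiniteDimensional ℝ E] [Nontrivial F]
    [(volume : Measure F).IsAddHaarMeasure] (hf : ‖f‖ = 1) (hA : ∀ z, inner ℝ f (A z) = 0)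
    {g : E} (hg : ‖g‖ = 1) (hgf : g ≠ f) (s r : ℝ) :
    volume {z : F | horo g (chart f A s z) = r} = 0 := by
  have hc : inner ℝ g f < 1 := (inner_lt_one_iff_real_of_norm_eq_one hg hf).2 hgf
  set c := inner ℝ g f
  set α := (1 - c) / 2 * exp (-s) with hα
  have hα0 : 0 < α := by have := exp_pos (-s); rw [hα]; nlinarith
  set b : F := (LinearMap.adjoint A.toLinearMap) g with hb
  have hbz : ∀ z, inner ℝ g (A z) = inner ℝ b z := by
    intro z
    rw [hb, LinearMap.adjoint_inner_left]; rfl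
  set C := (r - (1 + c) / 2 * exp s - α) / α + ‖(1 / (2 * α)) • b‖ ^ 2 with hC
  refine measure_mono_null (t := Metric.sphere ((1 / (2 * α)) • b) √C) ?_
    (Measure.addHaar_sphere volume _ _)
  intro z hz
  rw [mem_ofPred_eq, horo_chart hf hA, hbz] at hz
  have : ‖z - (1 / (2 * α)) • b‖ ^ 2 = C := by
    rw [norm_sub_sq_real, real_inner_smul_right, hC, real_inner_comm, ← hz]
    field_simp
    simp only [hα]
    ring
  rw [mem_sphere_iff_norm, ← this, Real.sqrt_sq (norm_nonneg _)]

end Chart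

/-- Every unit vector of a Euclidean space belongs to a frame. -/
lemma exists_isFrame {n : ℕ} {f : EuclideanSpace ℝ (Fin (n + 1))} (hf : ‖f‖ = 1) :
    ∃ A : EuclideanSpace ℝ (Fin n) →ₗᵢ[ℝ] EuclideanSpace ℝ (Fin (n + 1)), IsFrame f A := by
  obtain ⟨b, hb⟩ : ∃ b : OrthonormalBasis (Fin (n + 1)) ℝ (EuclideanSpace ℝ (Fin (n + 1))),
      ∀ i ∈ ({0} : Set (Fin (n + 1))), b i = f := by
    have ho : Orthonormal ℝ (({0} : Set (Fin (n + 1))).domRestrict fun _ => f) := by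
      refine ⟨fun i => hf, fun i j hij => ?_⟩
      exact absurd (Subsingleton.elim i j) hij
    exact ho.exists_orthonormalBasis_extension_of_card_eq (by simp)
  have hb0 : b 0 = f := hb 0 rfl
  have hosucc : Orthonormal ℝ (fun k : Fin n => b k.succ) :=
    b.orthonormal.comp _ (Fin.succ_injective n)
  set e := EuclideanSpace.basisFun (Fin n) ℝ
  set L : EuclideanSpace ℝ (Fin n) →ₗ[ℝ] EuclideanSpace ℝ (Fin (n + 1)) :=
    e.toBasis.constr ℝ (fun k => b k.succ) with hL
  have hLe : ∀ k, L (e k) = b k.succ := fun k => by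
    rw [hL, ← e.coe_toBasis, Module.Basis.constr_basis]
  set A : EuclideanSpace ℝ (Fin n) →ₗᵢ[ℝ] EuclideanSpace ℝ (Fin (n + 1)) :=
    L.isometryOfOrthonormal (v := e.toBasis) (by simp [e.orthonormal])
      (by convert hosucc using 1; ext1 k; simp [hLe])
  have hA : ∀ z, A z = ∑ k, z k • b k.succ := by
    intro z
    change L z = _
    conv_lhs => rw [← e.sum_repr z]
    rw [map_sum]
    refine Finset.sum_congr rfl fun k _ => ?_
    rw [map_smul, hLe]
    simp [e]
  have hsplit : ∀ q : ℝ × EuclideanSpace ℝ (Fin n), q.1 • f + A q.2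
      = b.repr.symm (WithLp.toLp 2 (Fin.cons q.1 q.2.ofLp : Fin (n + 1) → ℝ)) := by
    intro q
    rw [← b.sum_repr_symm, Fin.sum_univ_succ, hA, hb0]
    simp
  refine ⟨A, hf, ?_, ?_, ?_⟩
  · intro z
    rw [hA, inner_sum]
    refine Finset.sum_eq_zero fun k _ => ?_
    rw [real_inner_smul_right, ← hb0, b.orthonormal.2 (Fin.succ_ne_zero k).symm, mul_zero]
  · intro x
    refine ⟨WithLp.toLp 2 fun k => inner ℝ (b k.succ) x, ?_⟩
    rw [hA]
    conv_lhs => rw [← b.sum_repr' x, Fin.sum_univ_succ, hb0]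
  · have h1 : MeasurePreserving (fun q : ℝ × EuclideanSpace ℝ (Fin n) => (q.1, q.2.ofLp))
        ((volume : Measure ℝ).prod volume) ((volume : Measure ℝ).prod volume) :=
      (MeasurePreserving.id _).prod (PiLp.volume_preserving_ofLp (Fin n))
    have h2 := (volume_preserving_piFinSuccAbove (fun _ : Fin (n + 1) => ℝ) 0).symm
    have h3 := PiLp.volume_preserving_toLp (Fin (n + 1))
    have h4 := b.measurePreserving_repr_symm
    have := h4.comp (h3.comp (h2.comp h1))
    convert this using 1
    ext1 q
    rw [hsplit]
    simp [Fin.insertNthEquiv]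

section Hausdorff

lemma le_ediamWith {α : Type*} (d : α → α → ℝ) {U : Set α} {x y : α} (hx : x ∈ U) (hy : y ∈ U) :
    ENNReal.ofReal (d x y) ≤ ediamWith d U :=
  le_iSup₂_of_le x hx (le_iSup₂_of_le y hy le_rfl)

lemma exists_pos_two_mul_sinh_half_le {c : ℝ} (hc : 1 < c) :
    ∃ η > 0, ∀ x, 0 ≤ x → x ≤ η → 2 * Real.sinh (x / 2) ≤ c * x := by
  have hd : ∀ x, HasDerivAt (fun x : ℝ => 2 * Real.sinh (x / 2)) (Real.cosh (x / 2)) x := fun x =>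
    (((hasDerivAt_id x).div_const 2).sinh.const_mul 2).congr_deriv (by simp; ring)
  have hcont : ContinuousAt (fun x : ℝ => Real.cosh (x / 2)) 0 := by fun_prop
  have hev : ∀ᶠ x in 𝓝 (0 : ℝ), Real.cosh (x / 2) < c :=
    hcont.eventually (gt_mem_nhds (by simpa using hc))
  obtain ⟨η, hη, hη'⟩ := Metric.eventually_nhds_iff.1 hev
  refine ⟨η / 2, by positivity, fun x hx0 hx => ?_⟩
  have := Convex.image_sub_le_mul_sub_of_deriv_le (convex_Icc 0 (η / 2))
    (f := fun x : ℝ => 2 * Real.sinh (x / 2)) (C := c) (by fun_prop)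
    (fun x _ => (hd x).differentiableAt.differentiableWithinAt) (fun y hy => ?_) 0
    (by constructor <;> linarith) x ⟨hx0, hx⟩ hx0
  · simpa using this
  · rw [(hd y).deriv]
    rw [interior_Icc] at hy
    refine (hη' ?_).le
    rw [Real.dist_eq, sub_zero, abs_of_pos hy.1]
    linarith [hy.2]

variable {α F : Type*} [NormedAddCommGroup F] [MeasurableSpace F] [BorelSpace F]

/-- A parametrization by the chordal distance `2 arsinh (r / 2)` preserves Hausdorff measures. -/
lemma hMeasWith_image {d : α → α → ℝ} {φ : F → α}
    (hd : ∀ z w, d (φ z) (φ w) = 2 * Real.arsinh (‖z - w‖ / 2)) {n : ℕ} (hn : n ≠ 0) (Z : Set F) :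
    hMeasWith d n (φ '' Z) = Measure.hausdorffMeasure (n : ℝ) Z := by
  have hn0 : (0 : ℝ) < n := by positivity
  have hnorm : ∀ z w, ‖z - w‖ = 2 * Real.sinh (d (φ z) (φ w) / 2) := by
    intro z w
    rw [hd, mul_div_cancel_left₀ _ two_ne_zero, Real.sinh_arsinh]; ring
  have hd0 : ∀ z w, 0 ≤ d (φ z) (φ w) := by
    intro z w
    rw [hd]
    have : 0 ≤ Real.arsinh (‖z - w‖ / 2) := Real.arsinh_nonneg_iff.2 (by positivity)
    linarith
  have hle : ∀ z w, d (φ z) (φ w) ≤ ‖z - w‖ := by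
    intro z w
    rw [hnorm]
    have := Real.self_le_sinh_iff.2 (show 0 ≤ d (φ z) (φ w) / 2 by have := hd0 z w; linarith)
    linarith
  have hdiam : ∀ W : Set F, ediamWith d (φ '' W) ≤ Metric.ediam W := by
    intro W
    refine iSup₂_le fun x hx => iSup₂_le fun y hy => ?_
    obtain ⟨z, hz, rfl⟩ := hx
    obtain ⟨w, hw, rfl⟩ := hy
    refine le_trans ?_ (Metric.edist_le_ediam_of_mem hz hw)
    rw [edist_dist, dist_eq_norm]
    exact ENNReal.ofReal_le_ofReal (hle z w)
  have hsummand : ∀ W : Set F, (⨆ _ : W.Nonempty, Metric.ediam W ^ (n : ℝ)) = Metric.ediam W ^ n := by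
    intro W
    rcases W.eq_empty_or_nonempty with rfl | hW
    · simp [hn]
    · simp [hW]
  rw [Measure.hausdorffMeasure_apply]
  simp only [hsummand]
  apply le_antisymm
  · refine iSup₂_le fun δ hδ => ?_
    refine le_iSup₂_of_le (ENNReal.ofReal δ) (ENNReal.ofReal_pos.2 hδ) ?_
    refine le_iInf fun t => le_iInf fun ht => le_iInf fun htd => ?_
    refine iInf_le_of_le (fun k => φ '' t k) (iInf_le_of_le ?_ (iInf_le_of_le ?_ ?_))
    · rw [← image_iUnion]; exact image_mono ht
    · exact fun k => (hdiam _).trans (htd k)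
    · exact ENNReal.tsum_le_tsum fun k => pow_le_pow_left' (hdiam _) n
  · refine iSup₂_le fun r hr => ?_
    have hmain : ∀ c : ℝ, 1 < c → (⨅ (t : ℕ → Set F) (_ : Z ⊆ ⋃ k, t k)
        (_ : ∀ k, Metric.ediam (t k) ≤ r), ∑' k, Metric.ediam (t k) ^ n)
        ≤ ENNReal.ofReal c ^ n * hMeasWith d n (φ '' Z) := by
      intro c hc
      obtain ⟨η, hη, hηc⟩ := exists_pos_two_mul_sinh_half_le hc
      obtain ⟨r', hr'0, hr'⟩ : ∃ r' : ℝ, 0 < r' ∧ ENNReal.ofReal (c * r') ≤ r := by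
        rcases eq_or_ne r ∞ with rfl | hrt
        · exact ⟨1, one_pos, le_top⟩
        · refine ⟨r.toReal / c, div_pos (ENNReal.toReal_pos hr.ne' hrt) (by linarith), ?_⟩
          rw [mul_div_cancel₀ _ (by linarith), ENNReal.ofReal_toReal hrt]
      have hback : ∀ U : Set α, ediamWith d U ≤ ENNReal.ofReal (min η r') →
          Metric.ediam (φ ⁻¹' U) ≤ ENNReal.ofReal c * ediamWith d U := by
        intro U hU
        refine Metric.ediam_le fun z hz w hw => ?_
        have h1 := le_ediamWith d (U := U) hz hw
        have h2 : d (φ z) (φ w) ≤ min η r' :=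
          (ENNReal.ofReal_le_ofReal_iff (by positivity)).1 (h1.trans hU)
        rw [edist_dist, dist_eq_norm, hnorm]
        refine le_trans (ENNReal.ofReal_le_ofReal (hηc _ (hd0 z w) (h2.trans (min_le_left _ _)))) ?_
        rw [ENNReal.ofReal_mul (by linarith)]
        gcongr
      have hstep : (⨅ (t : ℕ → Set F) (_ : Z ⊆ ⋃ k, t k)
          (_ : ∀ k, Metric.ediam (t k) ≤ r), ∑' k, Metric.ediam (t k) ^ n)
          ≤ ENNReal.ofReal c ^ n * ⨅ (U : ℕ → Set α) (_ : φ '' Z ⊆ ⋃ i, U i)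
            (_ : ∀ i, ediamWith d (U i) ≤ ENNReal.ofReal (min η r')), ∑' i, ediamWith d (U i) ^ n := by
        have hct : ENNReal.ofReal c ^ n ≠ ∞ := ENNReal.pow_ne_top ENNReal.ofReal_ne_top
        have hc0 : ENNReal.ofReal c ^ n ≠ 0 := pow_ne_zero _ (by simp; linarith)
        simp only [ENNReal.mul_iInf_of_ne hc0 hct]
        refine le_iInf fun U => le_iInf fun hU => le_iInf fun hUd => ?_
        refine iInf_le_of_le (fun k => φ ⁻¹' U k) (iInf_le_of_le ?_ (iInf_le_of_le ?_ ?_))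
        · rw [← preimage_iUnion]; exact image_subset_iff.1 hU
        · intro k
          refine (hback _ (hUd k)).trans (le_trans ?_ hr')
          rw [ENNReal.ofReal_mul (by linarith)]
          gcongr
          exact (hUd k).trans (ENNReal.ofReal_le_ofReal (min_le_right _ _))
        · rw [← ENNReal.tsum_mul_left]
          refine ENNReal.tsum_le_tsum fun k => ?_
          rw [← mul_pow]
          exact pow_le_pow_left' (hback _ (hUd k)) n
      refine hstep.trans ?_
      gcongr
      exact le_iSup₂_of_le (f := fun (δ : ℝ) (_ : 0 < δ) =>
        ⨅ (U : ℕ → Set α) (_ : φ '' Z ⊆ ⋃ i, U i)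
          (_ : ∀ i, ediamWith d (U i) ≤ ENNReal.ofReal δ), ∑' i, ediamWith d (U i) ^ n)
        (min η r') (by positivity) le_rfl
    have hlim : Tendsto (fun c : ℝ => ENNReal.ofReal c ^ n * hMeasWith d n (φ '' Z)) (𝓝[>] 1)
        (𝓝 (hMeasWith d n (φ '' Z))) := by
      have h1 : Tendsto (fun c : ℝ => ENNReal.ofReal c ^ n) (𝓝[>] 1) (𝓝 1) := by
        have : Continuous (fun c : ℝ => ENNReal.ofReal c ^ n) :=
          (ENNReal.continuous_pow n).comp ENNReal.continuous_ofReal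
        simpa using (this.tendsto 1).mono_left nhdsWithin_le_nhds
      simpa using ENNReal.Tendsto.mul_const h1 (Or.inl one_ne_zero)
    exact ge_of_tendsto hlim (eventually_nhdsWithin_of_forall hmain)

/-- The Hausdorff measure of a Euclidean space is a positive multiple of the Lebesgue measure. -/
lemma exists_hausdorffMeasure_eq (n : ℕ) : ∃ c : ℝ≥0∞, c ≠ 0 ∧ c ≠ ∞ ∧
    ∀ Z : Set (EuclideanSpace ℝ (Fin n)), Measure.hausdorffMeasure (n : ℝ) Z = c * volume Z := by
  have h : (Measure.hausdorffMeasure (n : ℝ) :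
      Measure (EuclideanSpace ℝ (Fin n))).IsAddHaarMeasure := by
    simpa using isAddHaarMeasure_hausdorffMeasure (E := EuclideanSpace ℝ (Fin n))
  set μ : Measure (EuclideanSpace ℝ (Fin n)) := Measure.hausdorffMeasure (n : ℝ)
  refine ⟨Measure.addHaarScalarFactor μ volume, ?_, ENNReal.coe_ne_top, fun Z => ?_⟩
  · exact_mod_cast (Measure.addHaarScalarFactor_pos_of_isAddHaarMeasure μ volume).ne'
  · conv_lhs => rw [Measure.isAddLeftInvariant_eq_smul μ volume]
    rfl

end Hausdorff

section Variation

/-- A function with continuous partial derivatives is differentiable along lines. -/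
lemma hasDerivAt_line_of_partial {ι : Type*} [Fintype ι] [DecidableEq ι] {V : (ι → ℝ) → ℝ}
    {S : ι → (ι → ℝ) → ℝ} (hS : ∀ k, Continuous (S k))
    (hV : ∀ k w b, HasDerivAt (fun b => V (Function.update w k b)) (S k (Function.update w k b)) b)
    (w d : ι → ℝ) :
    HasDerivAt (fun t : ℝ => V (w + t • d)) (∑ k, d k * S k w) 0 := by
  have main : ∀ s : Finset ι, HasDerivAt
      (fun t : ℝ => V (fun k => if k ∈ s then w k + t * d k else w k)) (∑ k ∈ s, d k * S k w) 0 := by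
    intro s
    induction s using Finset.induction_on with
    | empty => simpa using hasDerivAt_const (0 : ℝ) (V w)
    | insert k s hk ih =>
      set P : ℝ → ι → ℝ := fun t l => if l ∈ s then w l + t * d l else w l with hP
      have hPk : ∀ t, P t k = w k := fun t => by simp [hP, hk]
      have hsplit : ∀ t, V (fun l => if l ∈ insert k s then w l + t * d l else w l)
          = V (P t) + (V (Function.update (P t) k (w k + t * d k))
            - V (Function.update (P t) k (w k))) := by
        intro t
        have h1 : Function.update (P t) k (w k) = P t := by rw [← hPk t, Function.update_eq_self]
        have h2 : Function.update (P t) k (w k + t * d k)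
            = fun l => if l ∈ insert k s then w l + t * d l else w l := by
          ext l
          rcases eq_or_ne l k with rfl | hl
          · simp
          · simp [hl, hP]
        rw [h1, h2]; ring
      simp only [hsplit]
      rw [Finset.sum_insert hk, add_comm]
      refine ih.fun_add ?_
      rw [hasDerivAt_iff_isLittleO, Asymptotics.isLittleO_iff]
      intro c hc
      obtain ⟨r, hr, hr'⟩ := Metric.continuousAt_iff.1 (hS k).continuousAt (c / (‖d k‖ + 1))
        (by positivity)
      have hev : ∀ᶠ t : ℝ in 𝓝 0, |t| * ‖d‖ < r := by
        have : Continuous fun t : ℝ => |t| * ‖d‖ := by fun_prop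
        exact this.continuousAt.eventually (gt_mem_nhds (by simpa using hr))
      filter_upwards [hev] with t ht
      have hb : ∀ l, |t * d l| ≤ |t| * ‖d‖ := fun l => by
        rw [abs_mul]; gcongr; exact norm_le_pi_norm d l
      have hclose : ∀ y ∈ uIcc (w k) (w k + t * d k),
          dist (S k (Function.update (P t) k y)) (S k w) < c / (‖d k‖ + 1) := by
        intro y hy
        refine hr' (lt_of_le_of_lt ((dist_pi_le_iff (by positivity)).2 fun l => ?_) ht)
        rcases eq_or_ne l k with rfl | hl
        · rw [Function.update_self, Real.dist_eq]
          refine le_trans ?_ (hb l)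
          simpa using abs_sub_left_of_mem_uIcc hy
        · rw [Function.update_of_ne hl, Real.dist_eq]
          by_cases hls : l ∈ s
          · simpa [hP, hls] using hb l
          · simp only [hP, hls, if_false, sub_self, abs_zero]; positivity
      have := (convex_uIcc (w k) (w k + t * d k)).norm_image_sub_le_of_norm_hasDerivWithin_le
        (f := fun y => V (Function.update (P t) k y) - y * S k w)
        (f' := fun y => S k (Function.update (P t) k y) - S k w) (C := c / (‖d k‖ + 1))
        (fun y _ => ((hV k (P t) y).sub ((hasDerivAt_id y).mul_const (S k w))).hasDerivWithinAt
          |>.congr_deriv (by simp))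
        (fun y hy => by rw [← dist_eq_norm]; exact (hclose y hy).le)
        left_mem_uIcc right_mem_uIcc
      have h0 : ∀ x, x + 0 * d k = x := by intro x; ring
      rw [h0, sub_self, sub_zero]
      calc _ = ‖V (Function.update (P t) k (w k + t * d k)) - (w k + t * d k) * S k w
            - (V (Function.update (P t) k (w k)) - w k * S k w)‖ := by
              congr 1; simp only [smul_eq_mul, sub_zero]; ring
        _ ≤ c / (‖d k‖ + 1) * ‖w k + t * d k - w k‖ := this
        _ = c * ‖t‖ * (‖d k‖ / (‖d k‖ + 1)) := by
          rw [add_sub_cancel_left, norm_mul]; ring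
        _ ≤ c * ‖t‖ * 1 := by
          gcongr
          rw [div_le_one (by positivity)]; linarith
        _ = c * ‖t - 0‖ := by rw [sub_zero, mul_one]
  have := main Finset.univ
  simp only [Finset.mem_univ, if_true] at this
  exact this

/-- The measure of a bounded sublevel set depends continuously on parameters provided the level
set is null. -/
lemma tendsto_measure_sublevel {X W κ : Type*} [Finite κ] [TopologicalSpace W]
    [FirstCountableTopology W] [MeasurableSpace X] {μ : Measure X} {g : κ → W → X → ℝ} {w₀ : W}
    (hcont : ∀ i x, ContinuousAt (fun w => g i w x) w₀) (hmeas : ∀ i w, Measurable (g i w))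
    (hnull : ∀ i, μ {x | g i w₀ x = 0} = 0) {B : Set X} (hBm : MeasurableSet B) (hB : μ B ≠ ∞)
    (hsub : ∀ᶠ w in 𝓝 w₀, {x | ∀ i, g i w x ≤ 0} ⊆ B) :
    ContinuousAt (fun w => μ {x | ∀ i, g i w x ≤ 0}) w₀ := by
  have hm : ∀ w, MeasurableSet {x | ∀ i, g i w x ≤ 0} := fun w => by
    rw [show {x | ∀ i, g i w x ≤ 0} = ⋂ i, g i w ⁻¹' Iic 0 by ext; simp]
    exact MeasurableSet.iInter fun i => hmeas i w measurableSet_Iic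
  refine tendsto_measure_of_ae_tendsto_indicator (𝓝 w₀) (hm w₀) hm hBm hB hsub ?_
  have hae : ∀ᵐ x ∂μ, ∀ i, g i w₀ x ≠ 0 := by
    rw [eventually_countable_forall]
    intro i
    rw [ae_iff]
    simpa using hnull i
  filter_upwards [hae] with x hx
  by_cases h : ∀ i, g i w₀ x ≤ 0
  · have : ∀ᶠ w in 𝓝 w₀, ∀ i, g i w x < 0 := eventually_all.2 fun i =>
      (hcont i x).eventually (gt_mem_nhds (lt_of_le_of_ne (h i) (hx i)))
    filter_upwards [this] with w hw
    exact iff_of_true (fun i => (hw i).le) h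
  · obtain ⟨i, hi⟩ := not_forall.1 h
    filter_upwards [(hcont i x).eventually (lt_mem_nhds (not_le.1 hi))] with w hw
    exact iff_of_false (fun h' => absurd (h' i) (not_le.2 hw)) h

end Variation

section Body

variable {n : ℕ} {ι : Type*}

/-- The graph parametrization of an intersection of horo-balls. -/
def body (f : ι → EuclideanSpace ℝ (Fin (n + 1))) (w : ι → ℝ) :
    Set (EuclideanSpace ℝ (Fin (n + 1))) :=
  {x | ∀ k, horo (f k) x ≤ exp (w k)}

/-- The part of the `k`-th bounding horosphere satisfying the remaining constraints. -/
def slice (f : ι → EuclideanSpace ℝ (Fin (n + 1)))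
    (A : ι → EuclideanSpace ℝ (Fin n) →ₗᵢ[ℝ] EuclideanSpace ℝ (Fin (n + 1)))
    (k : ι) (w : ι → ℝ) : Set (EuclideanSpace ℝ (Fin n)) :=
  {z | ∀ l : {l // l ≠ k}, horo (f l) (chart (f k) (A k) (w k) z) ≤ exp (w l)}

/-- The hyperbolic volume of an intersection of horo-balls. -/
def bodyVol (f : ι → EuclideanSpace ℝ (Fin (n + 1))) (w : ι → ℝ) : ℝ :=
  (hvol _ (body f w)).toReal

/-- The area of the part of the `k`-th bounding horosphere satisfying the remaining constraints. -/
def sliceVol (f : ι → EuclideanSpace ℝ (Fin (n + 1)))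
    (A : ι → EuclideanSpace ℝ (Fin n) →ₗᵢ[ℝ] EuclideanSpace ℝ (Fin (n + 1)))
    (k : ι) (w : ι → ℝ) : ℝ :=
  (volume (slice f A k w)).toReal

variable {f : ι → EuclideanSpace ℝ (Fin (n + 1))}
  {A : ι → EuclideanSpace ℝ (Fin n) →ₗᵢ[ℝ] EuclideanSpace ℝ (Fin (n + 1))}

lemma hvol_le_volume (B : Set (EuclideanSpace ℝ (Fin (n + 1)))) : hvol _ B ≤ volume B := by
  have h : hvol (EuclideanSpace ℝ (Fin (n + 1))) ≤ volume.withDensity 1 :=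
    withDensity_mono (ae_of_all _ fun x => by
      rw [Pi.one_apply, ENNReal.ofReal_le_one, div_le_one (height_pos x)]
      exact one_le_height x)
  rw [withDensity_one] at h
  exact h B

lemma hvol_closedBall_ne_top (r : ℝ) :
    hvol (EuclideanSpace ℝ (Fin (n + 1))) (Metric.closedBall 0 r) ≠ ∞ :=
  ne_top_of_le_ne_top measure_closedBall_lt_top.ne (hvol_le_volume _)

lemma height_le_of_mem_body {w : ι → ℝ} {k l : ι} (hkl : f l = -f k)
    {x : EuclideanSpace ℝ (Fin (n + 1))} (hx : x ∈ body f w) :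
    height x ≤ (exp (w k) + exp (w l)) / 2 := by
  have h1 := hx k
  have h2 := hx l
  rw [hkl] at h2
  simp only [horo, inner_neg_left] at h1 h2
  linarith

lemma body_subset_closedBall {w : ι → ℝ} {k l : ι} (hkl : f l = -f k) :
    body f w ⊆ Metric.closedBall 0 ((exp (w k) + exp (w l)) / 2) := fun x hx => by
  rw [mem_closedBall_zero_iff]
  exact (norm_lt_height x).le.trans (height_le_of_mem_body hkl hx)

lemma isClosed_body (w : ι → ℝ) : IsClosed (body f w) := by
  rw [show body f w = ⋂ k, {x | horo (f k) x ≤ exp (w k)} by ext; simp [body]]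
  exact isClosed_iInter fun k => isClosed_le (continuous_horo _) continuous_const

variable (hA : ∀ k, IsFrame (f k) (A k)) (hneg : ∀ k, ∃ l, f l = -f k)

lemma ne_of_neg {k l : ι} (hf : ‖f k‖ = 1) (hkl : f l = -f k) : l ≠ k := by
  rintro rfl
  have h : inner ℝ (f l) (f l) = -inner ℝ (f l) (f l) := by
    conv_lhs => rw [hkl, inner_neg_left, ← hkl]
  rw [real_inner_self_eq_norm_sq, hf] at h
  norm_num at h

include hA hneg

lemma exists_slice_subset_closedBall (k : ι) : ∃ l, ∀ w : ι → ℝ,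
    slice f A k w ⊆ Metric.closedBall 0 (exp (w k + w l)) := by
  obtain ⟨l, hl⟩ := hneg k
  refine ⟨l, fun w z hz => ?_⟩
  have h := hz ⟨l, ne_of_neg (hA k).norm_eq hl⟩
  simp only [hl, horo_neg_chart (hA k).norm_eq (hA k).inner_eq] at h
  rw [mem_closedBall_zero_iff]
  have h3 : 1 + ‖z‖ ^ 2 ≤ exp (w k + w l) := by
    rw [exp_add]
    calc 1 + ‖z‖ ^ 2 = exp (w k) * (exp (-w k) * (1 + ‖z‖ ^ 2)) := by
          rw [← mul_assoc, ← exp_add]; simp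
      _ ≤ _ := by gcongr
  nlinarith [sq_nonneg (‖z‖ - 1), norm_nonneg z]

variable [Finite ι]

lemma continuous_volume_slice [NeZero n] (hinj : Function.Injective f) (k : ι) :
    Continuous (fun w => volume (slice f A k w)) := by
  rw [continuous_iff_continuousAt]
  intro w₀
  obtain ⟨l, hl⟩ := exists_slice_subset_closedBall hA hneg k
  have hev : ∀ᶠ w : ι → ℝ in 𝓝 w₀, exp (w k + w l) < exp (w₀ k + w₀ l) + 1 := by
    have : Continuous fun w : ι → ℝ => exp (w k + w l) := by fun_prop
    exact this.continuousAt.eventually (gt_mem_nhds (by simp))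
  have := tendsto_measure_sublevel (μ := (volume : Measure (EuclideanSpace ℝ (Fin n)))) (w₀ := w₀)
    (g := fun (l : {l // l ≠ k}) (w : ι → ℝ) z =>
      horo (f l) (chart (f k) (A k) (w k) z) - exp (w l))
    (B := Metric.closedBall 0 (exp (w₀ k + w₀ l) + 1)) ?_ ?_ ?_ measurableSet_closedBall
    measure_closedBall_lt_top.ne ?_
  · simp only [sub_nonpos] at this
    exact this
  · intro i z
    have h1 : Continuous fun w : ι → ℝ => chart (f k) (A k) (w k) z := by
      unfold chart; fun_prop
    have h2 : Continuous fun w : ι → ℝ => horo (f i) (chart (f k) (A k) (w k) z) :=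
      (continuous_horo (f i)).comp h1
    have h3 : Continuous fun w : ι → ℝ => exp (w i) := by fun_prop
    exact (h2.sub h3).continuousAt
  · intro i w
    exact (((continuous_horo (f i)).comp (continuous_chart (w k))).sub continuous_const).measurable
  · intro i
    simp only [sub_eq_zero]
    exact volume_horo_chart_eq (hA k).norm_eq (hA k).inner_eq (hA i).norm_eq
      (fun h => i.2 (hinj h)) _ _
  · filter_upwards [hev] with w hw
    simp only [sub_nonpos]
    exact (hl w).trans (Metric.closedBall_subset_closedBall hw.le)

omit [Finite ι] in
lemma volume_slice_ne_top (k : ι) (w : ι → ℝ) : volume (slice f A k w) ≠ ∞ := by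
  obtain ⟨l, hl⟩ := exists_slice_subset_closedBall hA hneg k
  exact ne_top_of_le_ne_top measure_closedBall_lt_top.ne (measure_mono (hl w))

lemma continuous_sliceVol [NeZero n] (hinj : Function.Injective f) (k : ι) :
    Continuous (sliceVol f A k) :=
  continuous_iff_continuousAt.2 fun w =>
    (ENNReal.tendsto_toReal (volume_slice_ne_top hA hneg k w)).comp
      (continuous_volume_slice hA hneg hinj k).continuousAt

omit hA [Finite ι] in
lemma hvol_body_ne_top [Nonempty ι] (w : ι → ℝ) : hvol _ (body f w) ≠ ∞ := by
  obtain ⟨l, hl⟩ := hneg (Classical.arbitrary ι)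
  exact ne_top_of_le_ne_top (hvol_closedBall_ne_top _) (measure_mono (body_subset_closedBall hl))

lemma continuous_bodyVol [Nonempty ι] : Continuous (bodyVol f) := by
  rw [continuous_iff_continuousAt]
  intro w₀
  refine (ENNReal.tendsto_toReal (hvol_body_ne_top hneg w₀)).comp ?_
  set k := Classical.arbitrary ι
  obtain ⟨l, hl⟩ := hneg k
  have hev : ∀ᶠ w : ι → ℝ in 𝓝 w₀,
      (exp (w k) + exp (w l)) / 2 < (exp (w₀ k) + exp (w₀ l)) / 2 + 1 := by
    have : Continuous fun w : ι → ℝ => (exp (w k) + exp (w l)) / 2 := by fun_prop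
    exact this.continuousAt.eventually (gt_mem_nhds (by simp))
  have := tendsto_measure_sublevel (μ := hvol (EuclideanSpace ℝ (Fin (n + 1)))) (w₀ := w₀)
    (g := fun (i : ι) (w : ι → ℝ) x => horo (f i) x - exp (w i))
    (B := Metric.closedBall 0 ((exp (w₀ k) + exp (w₀ l)) / 2 + 1)) ?_ ?_ ?_
    measurableSet_closedBall (hvol_closedBall_ne_top _) ?_
  · simp only [sub_nonpos] at this
    exact this
  · exact fun i z =>
      (continuous_const.sub (Real.continuous_exp.comp (continuous_apply i))).continuousAt
  · exact fun i w => ((continuous_horo (f i)).sub continuous_const).measurable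
  · intro i
    simp only [sub_eq_zero]
    rw [hvol_eq_lintegral (hA i)
      (isClosed_eq (continuous_horo (f i)) continuous_const).measurableSet]
    have h0 : ∀ᵐ s : ℝ, volume (chart (f i) (A i) s ⁻¹' {x | horo (f i) x = exp (w₀ i)}) = 0 := by
      filter_upwards [compl_mem_ae_iff.2 (measure_singleton (w₀ i))] with s hs
      have : chart (f i) (A i) s ⁻¹' {x | horo (f i) x = exp (w₀ i)} = ∅ := by
        ext z
        simpa [horo_chart_self (hA i).norm_eq (hA i).inner_eq] using hs
      rw [this, measure_empty]
    rw [lintegral_congr_ae h0, lintegral_zero]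
  · filter_upwards [hev] with w hw
    simp only [sub_nonpos]
    exact (body_subset_closedBall hl).trans (Metric.closedBall_subset_closedBall hw.le)

omit hneg [Finite ι] in
lemma hvol_body_update [DecidableEq ι] [NeZero n] (k : ι) (w : ι → ℝ) (b : ℝ) :
    hvol _ (body f (Function.update w k b))
      = ∫⁻ s in Iic b, volume (slice f A k (Function.update w k s)) := by
  rw [hvol_eq_lintegral (hA k) (isClosed_body _).measurableSet,
    ← lintegral_indicator measurableSet_Iic]
  refine lintegral_congr fun s => ?_
  have key : ∀ z, chart (f k) (A k) s z ∈ body f (Function.update w k b) ↔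
      s ≤ b ∧ z ∈ slice f A k (Function.update w k s) := by
    intro z
    constructor
    · intro h
      refine ⟨?_, fun l => ?_⟩
      · have := h k
        rwa [horo_chart_self (hA k).norm_eq (hA k).inner_eq, Function.update_self,
          exp_le_exp] at this
      · have := h l
        rw [Function.update_of_ne l.2] at this ⊢
        rwa [Function.update_self]
    · rintro ⟨hs, h⟩ l
      rcases eq_or_ne l k with rfl | hl
      · rwa [horo_chart_self (hA l).norm_eq (hA l).inner_eq, Function.update_self, exp_le_exp]
      · have := h ⟨l, hl⟩
        rw [Function.update_self] at this
        simpa only [Function.update_of_ne hl] using this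
  by_cases hs : s ≤ b
  · rw [indicator_of_mem (mem_Iic.2 hs)]
    congr 1
    ext z
    rw [mem_preimage, key]
    simp [hs]
  · rw [indicator_of_notMem (by simpa using hs)]
    convert measure_empty (μ := (volume : Measure (EuclideanSpace ℝ (Fin n))))
    ext z
    rw [mem_preimage, key]
    simp [hs]

/-- The partial derivatives of the volume are the areas of the facets. -/
lemma hasDerivAt_bodyVol_update [DecidableEq ι] [NeZero n] (hinj : Function.Injective f) (k : ι)
    (w : ι → ℝ) (b : ℝ) :
    HasDerivAt (fun b => bodyVol f (Function.update w k b))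
      (sliceVol f A k (Function.update w k b)) b := by
  have : Nonempty ι := ⟨k⟩
  have hup : Continuous fun s : ℝ => Function.update w k s := continuous_const.update k continuous_id
  have hm : Measurable fun s : ℝ => volume (slice f A k (Function.update w k s)) :=
    ((continuous_volume_slice hA hneg hinj k).comp hup).measurable
  have hc : Continuous fun s : ℝ => sliceVol f A k (Function.update w k s) :=
    (continuous_sliceVol hA hneg hinj k).comp hup
  have hint : ∀ c, IntegrableOn (fun s : ℝ => sliceVol f A k (Function.update w k s)) (Iic c) :=
    fun c => integrable_toReal_of_lintegral_ne_top hm.aemeasurable (by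
      rw [← hvol_body_update hA]
      exact hvol_body_ne_top hneg _)
  have hV : ∀ c, bodyVol f (Function.update w k c)
      = ∫ s in Iic c, sliceVol f A k (Function.update w k s) := by
    intro c
    rw [bodyVol, hvol_body_update hA]
    exact (integral_toReal hm.aemeasurable
      (ae_of_all _ fun s => (volume_slice_ne_top hA hneg k _).lt_top)).symm
  have hV' : ∀ c, bodyVol f (Function.update w k c) = bodyVol f (Function.update w k b)
      + ∫ s in b..c, sliceVol f A k (Function.update w k s) := by
    intro c
    rw [← intervalIntegral.integral_Iic_sub_Iic (hint b) (hint c), hV, hV]; ring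
  rw [funext hV']
  refine HasDerivAt.const_add _ ?_
  exact intervalIntegral.integral_hasDerivAt_right (hc.intervalIntegrable _ _)
    (hc.stronglyMeasurableAtFilter _ _) hc.continuousAt

end Body

section Optimization

/-- A Lagrange multiplier rule for a functional which is positive exactly on the open positive
orthant, under the constraint `∑ a i * ∫ s in 0..v i, exp (p * s) ≤ K`. -/
lemma exists_pos_critical_point {κ : Type*} [Fintype κ] [Nonempty κ] [DecidableEq κ] (p : ℝ)
    {a : κ → ℝ}
    (ha : ∀ i, 0 < a i) {V : (κ → ℝ) → ℝ} {S : κ → (κ → ℝ) → ℝ} (hVc : Continuous V)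
    (hV : ∀ v d, HasDerivAt (fun t : ℝ => V (v + t • d)) (∑ k, d k * S k v) 0)
    (hzero : ∀ v i, (∀ j, 0 ≤ v j) → v i = 0 → V v = 0)
    (hpos : ∀ v, (∀ i, 0 < v i) → 0 < V v) :
    ∃ v c, (∀ i, 0 < v i) ∧ ∀ i, S i v = c * (a i * exp (p * v i)) := by
  set φ : ℝ → ℝ := fun x => ∫ s in (0 : ℝ)..x, exp (p * s) with hφ
  have hφd : ∀ x, HasDerivAt φ (exp (p * x)) x := fun x => by
    have hc : Continuous fun s : ℝ => exp (p * s) := by fun_prop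
    exact intervalIntegral.integral_hasDerivAt_right (hc.intervalIntegrable _ _)
      (hc.stronglyMeasurableAtFilter _ _) hc.continuousAt
  have hφc : Continuous φ := continuous_iff_continuousAt.2 fun x => (hφd x).continuousAt
  have hφm : StrictMono φ := strictMono_of_hasDerivAt_pos hφd fun x => exp_pos _
  have hφ0 : φ 0 = 0 := by simp [hφ]
  obtain ⟨i₀, hi₀⟩ := Finite.exists_min a
  set K := a i₀ * φ 1
  have hK : 0 < K := mul_pos (ha i₀) (hφ0 ▸ hφm zero_lt_one)
  set Φ : (κ → ℝ) → ℝ := fun v => ∑ i, a i * φ (v i) with hΦ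
  have hΦc : Continuous Φ := by fun_prop
  set C : Set (κ → ℝ) := {v | (∀ i, 0 ≤ v i) ∧ Φ v ≤ K} with hC
  have hCsub : C ⊆ Icc 0 1 := fun v hv => by
    refine ⟨hv.1, fun i => hφm.le_iff_le.1 ?_⟩
    have h1 : a i * φ (v i) ≤ Φ v := Finset.single_le_sum (f := fun i => a i * φ (v i))
      (fun j _ => mul_nonneg (ha j).le (hφ0 ▸ hφm.monotone (hv.1 j))) (Finset.mem_univ i)
    have h2 : K ≤ a i * φ 1 :=
      mul_le_mul_of_nonneg_right (hi₀ i) (hφ0 ▸ hφm.monotone zero_le_one)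
    exact le_of_mul_le_mul_left (h1.trans (hv.2.trans h2)) (ha i)
  have hCcl : IsClosed C := by
    have h : IsClosed {v : κ → ℝ | ∀ i, 0 ≤ v i} := isClosed_Ici (a := (0 : κ → ℝ))
    exact h.inter (isClosed_le hΦc continuous_const)
  have hCcp : IsCompact C := isCompact_Icc.of_isClosed_subset hCcl hCsub
  obtain ⟨t₀, ht₀, ht₀'⟩ : ∃ t : ℝ, 0 < t ∧ Φ (fun _ => t) ≤ K := by
    have h1 : Continuous fun t : ℝ => Φ fun _ => t := by fun_prop
    have h2 : ∀ᶠ t : ℝ in 𝓝 0, (Φ fun _ => t) < K :=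
      h1.continuousAt.eventually (gt_mem_nhds (by simpa [hΦ, hφ0] using hK))
    obtain ⟨t, ht, ht'⟩ := ((h2.filter_mono nhdsWithin_le_nhds).and
      (self_mem_nhdsWithin (s := Ioi (0 : ℝ)))).exists
    exact ⟨t, ht', ht.le⟩
  obtain ⟨v, hvC, hvmax⟩ := hCcp.exists_isMaxOn ⟨_, fun _ => ht₀.le, ht₀'⟩ hVc.continuousOn
  have hv : ∀ i, 0 < v i := fun i => by
    refine lt_of_le_of_ne (hvC.1 i) fun h => ?_
    have h1 : V (fun _ => t₀) ≤ V v := hvmax ⟨fun _ => ht₀.le, ht₀'⟩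
    rw [hzero v i hvC.1 h.symm] at h1
    exact (hpos _ fun _ => ht₀).not_ge h1
  set g : κ → ℝ := fun i => a i * exp (p * v i) with hg
  have hgpos : ∀ i, 0 < g i := fun i => mul_pos (ha i) (exp_pos _)
  have hΦd : ∀ d : κ → ℝ, HasDerivAt (fun t : ℝ => Φ (v + t • d)) (∑ k, d k * g k) 0 := by
    intro d
    refine HasDerivAt.fun_sum fun k _ => ?_
    have h1 : HasDerivAt (fun t : ℝ => v k + t * d k) (d k) 0 := by
      simpa using ((hasDerivAt_id (0 : ℝ)).mul_const (d k)).const_add (v k)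
    have h2 := (HasDerivAt.comp (0 : ℝ) (hφd (v k + 0 * d k)) h1).const_mul (a k)
    refine h2.congr_deriv ?_
    simp only [zero_mul, add_zero, hg]; ring
  have hfirst : ∀ d : κ → ℝ, ∑ k, d k * g k < 0 → ∑ k, d k * S k v ≤ 0 := by
    intro d hd
    have hle : 𝓝[>] (0 : ℝ) ≤ 𝓝[≠] 0 := nhdsWithin_mono _ fun x hx => ne_of_gt hx
    have h1 : ∀ᶠ t : ℝ in 𝓝[>] 0, slope (fun t : ℝ => Φ (v + t • d)) 0 t < 0 :=
      ((hasDerivAt_iff_tendsto_slope.1 (hΦd d)).eventually (gt_mem_nhds hd)).filter_mono hle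
    have h2 : ∀ᶠ t : ℝ in 𝓝[>] 0, ∀ i, 0 < v i + t * d i := by
      refine Filter.Eventually.filter_mono nhdsWithin_le_nhds (eventually_all.2 fun i => ?_)
      have : Continuous fun t : ℝ => v i + t * d i := by fun_prop
      exact this.continuousAt.eventually (lt_mem_nhds (by simpa using hv i))
    refine le_of_tendsto ((hasDerivAt_iff_tendsto_slope.1 (hV v d)).mono_left hle) ?_
    filter_upwards [h1, h2, self_mem_nhdsWithin] with t ht1 ht2 ht
    rw [mem_Ioi] at ht
    simp only [slope_def_field, zero_smul, add_zero, sub_zero] at ht1 ⊢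
    rw [div_neg_iff] at ht1
    have h3 : Φ (v + t • d) ≤ Φ v := by
      rcases ht1 with h | h <;> linarith
    have h4 : V (v + t • d) ≤ V v := hvmax ⟨fun i => (ht2 i).le, h3.trans hvC.2⟩
    exact div_nonpos_of_nonpos_of_nonneg (sub_nonpos.2 h4) ht.le
  have hle : ∀ d : κ → ℝ, ∑ k, d k * g k = 0 → ∑ k, d k * S k v ≤ 0 := by
    intro d hd
    have h1 : ∀ ε : ℝ, 0 < ε → ∑ k, d k * S k v ≤ ε * ∑ k, S k v := by
      intro ε hε
      have h2 := hfirst (fun k => d k - ε) (by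
        simp only [sub_mul, Finset.sum_sub_distrib, hd, ← Finset.mul_sum, zero_sub, neg_lt_zero]
        exact mul_pos hε (Finset.sum_pos (fun k _ => hgpos k) Finset.univ_nonempty))
      simp only [sub_mul, Finset.sum_sub_distrib, ← Finset.mul_sum] at h2
      linarith
    have h3 : Tendsto (fun ε : ℝ => ε * ∑ k, S k v) (𝓝[>] 0) (𝓝 0) := by
      have : Continuous fun ε : ℝ => ε * ∑ k, S k v := by fun_prop
      simpa using (this.tendsto 0).mono_left nhdsWithin_le_nhds
    refine ge_of_tendsto h3 ?_
    filter_upwards [self_mem_nhdsWithin] with ε hε using h1 ε hε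
  refine ⟨v, S i₀ v / g i₀, hv, fun i => ?_⟩
  have h1 : ∀ i j, g j * S i v ≤ g i * S j v := by
    intro i j
    have := hle (fun k => (if k = i then g j else 0) - if k = j then g i else 0) (by
      simp [sub_mul, mul_comm])
    simpa [sub_mul] using this
  have h2 := le_antisymm (h1 i i₀) (h1 i₀ i)
  have h3 := (hgpos i₀).ne'
  field_simp
  linarith

end Optimization

section SymmetricBody

variable {n : ℕ} {ι : Type*} {f : ι → EuclideanSpace ℝ (Fin (n + 1))}
  {A : ι → EuclideanSpace ℝ (Fin n) →ₗᵢ[ℝ] EuclideanSpace ℝ (Fin (n + 1))}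

lemma bodyVol_eq_zero {w : ι → ℝ} {k l : ι} (hkl : f l = -f k) (hk : w k = 0) (hl : w l = 0) :
    bodyVol f w = 0 := by
  have h : body f w ⊆ {0} := fun x hx => by
    have h1 := height_le_of_mem_body hkl hx
    rw [hk, hl, exp_zero] at h1
    have h2 : ‖x‖ ^ 2 ≤ 0 := by nlinarith [height_sq x, one_le_height x]
    exact norm_eq_zero.1 (pow_eq_zero_iff two_ne_zero |>.1 (le_antisymm h2 (sq_nonneg _)))
  have h0 : hvol _ (body f w) = 0 :=
    le_antisymm ((measure_mono h).trans ((hvol_le_volume _).trans (measure_singleton _).le)) bot_le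
  rw [bodyVol, h0, ENNReal.toReal_zero]

variable [Finite ι]

lemma bodyVol_pos [Nonempty ι] (hneg : ∀ k, ∃ l, f l = -f k) {w : ι → ℝ} (hw : ∀ k, 0 < w k) :
    0 < bodyVol f w := by
  refine ENNReal.toReal_pos ?_ (hvol_body_ne_top hneg w)
  have hac : (volume : Measure (EuclideanSpace ℝ (Fin (n + 1)))) ≪ hvol _ :=
    withDensity_absolutelyContinuous'
      ((ENNReal.measurable_ofReal.comp
        (measurable_const.div continuous_height.measurable)).aemeasurable)
      (ae_of_all _ fun x => by
        rw [ne_eq, ENNReal.ofReal_eq_zero, not_le]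
        exact one_div_pos.2 (height_pos x))
  have hopen : IsOpen {x | ∀ k, horo (f k) x < exp (w k)} := by
    simp only [ofPred_forall]
    exact isOpen_iInter_of_finite fun k => isOpen_lt (continuous_horo _) continuous_const
  have hne : {x | ∀ k, horo (f k) x < exp (w k)}.Nonempty :=
    ⟨0, fun k => by simpa [horo, height] using hw k⟩
  intro h
  exact (hopen.measure_pos volume hne).ne' (measure_mono_null (fun x hx k => (hx k).le) (hac h))

lemma sliceVol_pos (hA : ∀ k, IsFrame (f k) (A k)) (hneg : ∀ k, ∃ l, f l = -f k)
    (hinj : Function.Injective f) {w : ι → ℝ} {k : ι} (hk : 0 < w k) (hmin : ∀ l, w k ≤ w l) :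
    0 < sliceVol f A k w := by
  refine ENNReal.toReal_pos ?_ (volume_slice_ne_top hA hneg k w)
  set U := {z | ∀ l : {l // l ≠ k}, horo (f l) (chart (f k) (A k) (w k) z) < exp (w l)} with hU
  have hopen : IsOpen U := by
    simp only [hU, ofPred_forall]
    exact isOpen_iInter_of_finite fun l =>
      isOpen_lt ((continuous_horo _).comp (continuous_chart _)) continuous_const
  have hne : U.Nonempty := by
    refine ⟨0, fun l => lt_of_lt_of_le ?_ (exp_le_exp.2 (hmin l))⟩
    have hc : inner ℝ (f l) (f k) < 1 :=
      (inner_lt_one_iff_real_of_norm_eq_one (hA l).norm_eq (hA k).norm_eq).2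
        fun h => l.2 (hinj h)
    have he : exp (-w k) < exp (w k) := exp_lt_exp.2 (by linarith)
    rw [horo_chart (hA k).norm_eq (hA k).inner_eq]
    simp only [norm_zero, map_zero, inner_zero_right, ne_eq, OfNat.ofNat_ne_zero,
      not_false_eq_true, zero_pow]
    nlinarith
  exact ((hopen.measure_pos volume hne).trans_le (measure_mono fun z hz l => (hz l).le)).ne'

/-- For every even weight there is a symmetric intersection of horo-balls, bounded by horospheres
with the prescribed centres, whose facets have the prescribed weighted areas up to a factor. -/
theorem exists_symmetric_body [NeZero n] {κ : Type*} [Fintype κ] [Nonempty κ] [DecidableEq κ]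
    (p : ℝ) {e : κ → EuclideanSpace ℝ (Fin (n + 1))} (he : ∀ i, ‖e i‖ = 1)
    (hinj : Function.Injective (Sum.elim e fun i => -e i)) {a : κ → ℝ} (ha : ∀ i, 0 < a i) :
    ∃ (A : κ ⊕ κ → EuclideanSpace ℝ (Fin n) →ₗᵢ[ℝ] EuclideanSpace ℝ (Fin (n + 1)))
      (v : κ → ℝ) (c : ℝ), 0 < c ∧ (∀ i, 0 < v i) ∧
      (∀ k, IsFrame (Sum.elim e (fun i => -e i) k) (A k)) ∧
      ∀ k, sliceVol (Sum.elim e fun i => -e i) A k (Sum.elim v v)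
        = c * (Sum.elim a a k * exp (p * Sum.elim v v k)) := by
  set f := Sum.elim e fun i => -e i with hf
  choose A₀ hA₀ using fun i => exists_isFrame (he i)
  set A : κ ⊕ κ → EuclideanSpace ℝ (Fin n) →ₗᵢ[ℝ] EuclideanSpace ℝ (Fin (n + 1)) :=
    Sum.elim A₀ fun i => (A₀ i).comp (LinearIsometryEquiv.neg ℝ).toLinearIsometry
  have hA : ∀ k, IsFrame (f k) (A k) := by
    rintro (i | i)
    · exact hA₀ i
    · exact (hA₀ i).neg (Measure.measurePreserving_neg _)
  have hneg : ∀ k, ∃ l, f l = -f k := by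
    rintro (i | i)
    · exact ⟨Sum.inr i, rfl⟩
    · exact ⟨Sum.inl i, (neg_neg _).symm⟩
  have hsymm : ∀ i v, sliceVol f A (Sum.inr i) (Sum.elim v v)
      = sliceVol f A (Sum.inl i) (Sum.elim v v) := by
    intro i v
    have : slice f A (Sum.inr i) (Sum.elim v v) = slice f A (Sum.inl i) (Sum.elim v v) := by
      have hswap : ∀ (k : κ ⊕ κ) z,
          horo (f k.swap) (chart (f (Sum.inr i)) (A (Sum.inr i)) (v i) z)
            = horo (f k) (chart (f (Sum.inl i)) (A (Sum.inl i)) (v i) z) := by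
        intro k z
        have h1 : f k.swap = -f k := by rcases k with j | j <;> simp [hf]
        have h2 : chart (f (Sum.inr i)) (A (Sum.inr i)) (v i) z
            = -chart (f (Sum.inl i)) (A (Sum.inl i)) (v i) z := chart_neg _ _
        rw [h1, h2, horo_neg_neg]
      have hv : ∀ k : κ ⊕ κ, Sum.elim v v k.swap = Sum.elim v v k := by rintro (j | j) <;> rfl
      ext z
      constructor
      · rintro h ⟨l, hl⟩
        have := h ⟨l.swap, fun h' => hl (by rw [← Sum.swap_swap l, h']; rfl)⟩
        rwa [Sum.elim_inr, hswap, hv] at this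
      · rintro h ⟨l, hl⟩
        have := h ⟨l.swap, fun h' => hl (by rw [← Sum.swap_swap l, h']; rfl)⟩
        rw [Sum.elim_inl, ← hswap, hv] at this
        simpa only [Sum.swap_swap, Sum.elim_inr] using this
    rw [sliceVol, this, sliceVol]
  have helim : Continuous fun v : κ → ℝ => (Sum.elim v v : κ ⊕ κ → ℝ) :=
    continuous_pi fun k => by
      rcases k with i | i
      · exact continuous_apply i
      · exact continuous_apply i
  obtain ⟨v, c, hv, hc⟩ := exists_pos_critical_point p ha
    (V := fun v => bodyVol f (Sum.elim v v))
    (S := fun i v => 2 * sliceVol f A (Sum.inl i) (Sum.elim v v))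
    ((continuous_bodyVol hA hneg).comp helim)
    (fun v d => by
      have h := hasDerivAt_line_of_partial (V := bodyVol f) (S := sliceVol f A)
        (fun k => continuous_sliceVol hA hneg hinj k)
        (fun k w b => hasDerivAt_bodyVol_update hA hneg hinj k w b) (Sum.elim v v) (Sum.elim d d)
      have h1 : ∀ t : ℝ, (Sum.elim (v + t • d) (v + t • d) : κ ⊕ κ → ℝ)
          = Sum.elim v v + t • Sum.elim d d := fun t => by
        ext (i | i) <;> rfl
      simp only [h1]
      refine h.congr_deriv ?_
      rw [Fintype.sum_sum_type, ← Finset.sum_add_distrib]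
      refine Finset.sum_congr rfl fun i _ => ?_
      rw [hsymm, Sum.elim_inl, Sum.elim_inr]
      ring)
    (fun v i _ hi => bodyVol_eq_zero (k := Sum.inl i) (l := Sum.inr i) rfl hi hi)
    (fun v hv => bodyVol_pos hneg (by rintro (i | i) <;> exact hv i))
  obtain ⟨i₀, hi₀⟩ := Finite.exists_min v
  have hpos := sliceVol_pos (w := Sum.elim v v) (k := Sum.inl i₀) hA hneg hinj (hv i₀)
    (by rintro (i | i) <;> exact hi₀ i)
  have hc₀ : 0 < c := by
    have h1 := hc i₀
    have h2 : 0 < c * (a i₀ * exp (p * v i₀)) := by rw [← h1]; positivity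
    exact pos_of_mul_pos_left h2 (mul_pos (ha i₀) (exp_pos _)).le
  refine ⟨A, v, c / 2, by positivity, hv, hA, ?_⟩
  rintro (i | i)
  · simp only [Sum.elim_inl]
    linarith [hc i]
  · rw [hsymm]
    simp only [Sum.elim_inr]
    linarith [hc i]

end SymmetricBody

section Hyperboloid

variable {n : ℕ}

/-- The graph parametrization of the hyperboloid. -/
def emb (x : EuclideanSpace ℝ (Fin (n + 1))) : Fin (n + 2) → ℝ :=
  Fin.snoc (α := fun _ => ℝ) x.ofLp (height x)

@[simp]
lemma emb_castSucc (x : EuclideanSpace ℝ (Fin (n + 1))) (i : Fin (n + 1)) :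
    emb x i.castSucc = x i := Fin.snoc_castSucc (α := fun _ => ℝ) ..

@[simp]
lemma emb_last (x : EuclideanSpace ℝ (Fin (n + 1))) : emb x (Fin.last (n + 1)) = height x :=
  Fin.snoc_last (α := fun _ => ℝ) ..

lemma continuous_emb : Continuous (emb : EuclideanSpace ℝ (Fin (n + 1)) → _) := by
  refine continuous_pi fun i => ?_
  induction i using Fin.lastCases with
  | last => simpa using continuous_height
  | cast i => simp only [emb_castSucc]; fun_prop

lemma lprod_emb (x y : EuclideanSpace ℝ (Fin (n + 1))) :
    lprod n (emb x) (emb y) = inner ℝ x y - height x * height y := by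
  simp [lprod, PiLp.inner_apply, mul_comm]

lemma lprod_emb_dir (x f : EuclideanSpace ℝ (Fin (n + 1))) :
    lprod n (emb x) (dir f.ofLp) = -horo f x := by
  simp [lprod, dir, horo, PiLp.inner_apply]

lemma range_emb : range (emb : EuclideanSpace ℝ (Fin (n + 1)) → _) = Hyp n := by
  ext X
  constructor
  · rintro ⟨x, rfl⟩
    refine ⟨?_, by simpa using height_pos x⟩
    rw [lprod_emb, real_inner_self_eq_norm_sq]
    linarith [height_sq x]
  · rintro ⟨h1, h2⟩
    set x : EuclideanSpace ℝ (Fin (n + 1)) := WithLp.toLp 2 fun i => X i.castSucc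
    have hx : height x = X (Fin.last (n + 1)) := by
      rw [height, Real.sqrt_eq_iff_eq_sq (by positivity) h2.le, EuclideanSpace.real_norm_sq_eq]
      simp only [lprod, ← sq] at h1
      change 1 + ∑ i : Fin (n + 1), X i.castSucc ^ 2 = _
      linarith
    refine ⟨x, funext fun i => ?_⟩
    induction i using Fin.lastCases with
    | last => rw [emb_last, hx]
    | cast i => rw [emb_castSucc]

lemma emb_mem_Hyp (x : EuclideanSpace ℝ (Fin (n + 1))) : emb x ∈ Hyp n := range_emb ▸ ⟨x, rfl⟩

lemma mem_sph_iff (e : Fin (n + 1) → ℝ) : e ∈ sph n ↔ ‖WithLp.toLp 2 e‖ = 1 := by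
  rw [sph, mem_ofPred_eq, EuclideanSpace.norm_eq, Real.sqrt_eq_one]
  simp

lemma emb_zero : emb (0 : EuclideanSpace ℝ (Fin (n + 1))) = origin n := by
  ext i
  induction i using Fin.lastCases with
  | last => simp [origin, height]
  | cast i => simp [origin]

lemma symMap_emb (x : EuclideanSpace ℝ (Fin (n + 1))) : symMap n (emb x) = emb (-x) := by
  ext i
  induction i using Fin.lastCases with
  | last => simp [symMap, height]
  | cast i => simp [symMap, Fin.castSucc_ne_last]

lemma emb_mem_horoBallCl {f : EuclideanSpace ℝ (Fin (n + 1))} (hf : ‖f‖ = 1) (s : ℝ)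
    (x : EuclideanSpace ℝ (Fin (n + 1))) :
    emb x ∈ horoBallCl n f.ofLp s ↔ horo f x ≤ exp s := by
  simp [horoBallCl, emb_mem_Hyp, lprod_emb_dir, horo_pos hf]

lemma emb_mem_horoSphere (f : EuclideanSpace ℝ (Fin (n + 1))) (s : ℝ)
    (x : EuclideanSpace ℝ (Fin (n + 1))) :
    emb x ∈ horoSphere n f.ofLp s ↔ horo f x = exp s := by
  simp [horoSphere, emb_mem_Hyp, lprod_emb_dir]

lemma dH_origin_emb (x : EuclideanSpace ℝ (Fin (n + 1))) :
    dH n (origin n) (emb x) = Real.log (height x + ‖x‖) := by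
  rw [← emb_zero, dH, lprod_emb]
  have h : height (0 : EuclideanSpace ℝ (Fin (n + 1))) = 1 := by simp [height]
  rw [inner_zero_left, h, one_mul, zero_sub, neg_neg, neg_sq, height_sq, add_sub_cancel_left,
    Real.sqrt_sq (norm_nonneg x)]

lemma dH_emb_chart {f : EuclideanSpace ℝ (Fin (n + 1))}
    {A : EuclideanSpace ℝ (Fin n) →ₗᵢ[ℝ] EuclideanSpace ℝ (Fin (n + 1))} (hf : ‖f‖ = 1)
    (hA : ∀ z, inner ℝ f (A z) = 0) (s : ℝ) (z w : EuclideanSpace ℝ (Fin n)) :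
    dH n (emb (chart f A s z)) (emb (chart f A s w)) = 2 * Real.arsinh (‖z - w‖ / 2) := by
  have h1 : lprod n (emb (chart f A s z)) (emb (chart f A s w)) = -(1 + ‖z - w‖ ^ 2 / 2) := by
    rw [lprod_emb, height_chart hf hA, height_chart hf hA, chart, chart, inner_add_left,
      inner_add_right, inner_add_right, real_inner_smul_left, real_inner_smul_left,
      real_inner_smul_right, hA w, real_inner_smul_right, real_inner_comm f (A z), hA,
      real_inner_self_eq_norm_sq, hf, A.inner_map_map, norm_sub_sq_real]
    have : exp (-s) * exp s = 1 := by rw [← exp_add]; simp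
    linear_combination (-(1 + ‖z‖ ^ 2) / 2 - (1 + ‖w‖ ^ 2) / 2) * this
  set r := ‖z - w‖
  have hr : 0 ≤ r := norm_nonneg _
  have hq : √(1 + (r / 2) ^ 2) ^ 2 = 1 + (r / 2) ^ 2 := Real.sq_sqrt (by positivity)
  have h2 : √((-(1 + r ^ 2 / 2)) ^ 2 - 1) = r * √(1 + (r / 2) ^ 2) := by
    rw [Real.sqrt_eq_iff_eq_sq (by ring_nf; positivity) (by positivity), mul_pow, hq]
    ring
  rw [dH, h1, h2, Real.arsinh, ← Real.log_rpow (by positivity)]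
  congr 1
  rw [Real.rpow_two, add_sq, hq]
  ring

end Hyperboloid

section Polytope

variable {n : ℕ} {ι : Type*} {f : ι → EuclideanSpace ℝ (Fin (n + 1))} {w : ι → ℝ}

lemma isCompact_body [Nonempty ι] (hneg : ∀ k, ∃ l, f l = -f k) (w : ι → ℝ) :
    IsCompact (body f w) := by
  obtain ⟨l, hl⟩ := hneg (Classical.arbitrary ι)
  exact (isCompact_closedBall _ _).of_isClosed_subset (isClosed_body w) (body_subset_closedBall hl)

lemma bddAbove_log_horo [Nonempty ι] (hneg : ∀ k, ∃ l, f l = -f k)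
    {g : EuclideanSpace ℝ (Fin (n + 1))} (hg : ‖g‖ = 1) :
    BddAbove ((fun x => Real.log (horo g x)) '' body f w) :=
  (isCompact_body hneg w).bddAbove_image
    ((continuous_horo g).continuousOn.log fun x _ => (horo_pos hg x).ne')

lemma suppFn_image_emb (B : Set (EuclideanSpace ℝ (Fin (n + 1))))
    (g : EuclideanSpace ℝ (Fin (n + 1))) :
    suppFn n (emb '' B) g.ofLp = sSup ((fun x => Real.log (horo g x)) '' B) := by
  rw [suppFn, image_image]
  simp only [lprod_emb_dir, neg_neg]

lemma suppFn_eq {k : ι} (hk : ‖f k‖ = 1) {x : EuclideanSpace ℝ (Fin (n + 1))}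
    (hx : x ∈ body f w) (hxk : horo (f k) x = exp (w k)) :
    suppFn n (emb '' body f w) (f k).ofLp = w k := by
  rw [suppFn_image_emb]
  refine IsGreatest.csSup_eq ⟨⟨x, hx, by simp [hxk]⟩, ?_⟩
  rintro _ ⟨y, hy, rfl⟩
  exact (Real.log_le_iff_le_exp (horo_pos hk y)).2 (hy k)

lemma emb_image_body [Nonempty ι] (hf : ∀ k, ‖f k‖ = 1) :
    emb '' body f w = ⋂ k, horoBallCl n (f k).ofLp (w k) := by
  ext X
  rw [mem_iInter]
  constructor
  · rintro ⟨x, hx, rfl⟩ k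
    exact (emb_mem_horoBallCl (hf k) _ _).2 (hx k)
  · intro h
    obtain ⟨x, rfl⟩ : X ∈ range (emb (n := n)) := range_emb ▸ (h (Classical.arbitrary ι)).1
    exact ⟨x, fun k => (emb_mem_horoBallCl (hf k) _ _).1 (h k), rfl⟩

lemma origin_mem_relInt [Finite ι] [Nonempty ι] (hf : ∀ k, ‖f k‖ = 1) (hw : ∀ k, 0 < w k) :
    origin n ∈ relInt n (emb '' body f w) := by
  obtain ⟨k₀, hk₀⟩ := Finite.exists_min w
  refine ⟨emb_zero (n := n) ▸ emb_mem_Hyp _, w k₀, hw k₀, ?_⟩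
  intro Y hY hd
  obtain ⟨y, rfl⟩ : Y ∈ range (emb (n := n)) := range_emb ▸ hY
  refine ⟨y, fun k => ?_, rfl⟩
  rw [dH_origin_emb, Real.log_lt_iff_lt_exp (add_pos_of_pos_of_nonneg (height_pos y)
    (norm_nonneg y))] at hd
  exact (horo_le (hf k) y).trans (hd.le.trans (exp_le_exp.2 (hk₀ k)))

lemma isHConvexBody_image_body [Finite ι] [Nonempty ι] (hf : ∀ k, ‖f k‖ = 1)
    (hneg : ∀ k, ∃ l, f l = -f k) (hw : ∀ k, 0 < w k) :
    IsHConvexBody n (emb '' body f w) := by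
  have hcomp := (isCompact_body hneg w).image continuous_emb
  refine ⟨⟨?_, hcomp.isClosed, ?_⟩, hcomp, _, origin_mem_relInt hf hw⟩
  · rintro _ ⟨x, _, rfl⟩
    exact emb_mem_Hyp x
  · rintro _ ⟨⟨x, hx, rfl⟩, hcl⟩
    obtain ⟨k, hk⟩ : ∃ k, exp (w k) ≤ horo (f k) x := by
      by_contra! h
      have hopen : IsOpen {Y : Fin (n + 2) → ℝ |
          ∀ k, -lprod n Y (dir (f k).ofLp) < exp (w k)} := by
        simp only [ofPred_forall]
        refine isOpen_iInter_of_finite fun k => isOpen_lt ?_ continuous_const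
        unfold lprod; fun_prop
      obtain ⟨Y, hY, hYH, hYB⟩ := mem_closure_iff.1 hcl _ hopen fun k => by
        simpa only [lprod_emb_dir, neg_neg] using h k
      obtain ⟨y, rfl⟩ : Y ∈ range (emb (n := n)) := range_emb ▸ hYH
      refine hYB ⟨y, fun k => ?_, rfl⟩
      simpa only [lprod_emb_dir, neg_neg] using (hY k).le
    refine ⟨(f k).ofLp, (mem_sph_iff _).2 (hf k), w k, ?_, ?_⟩
    · rw [emb_image_body hf]
      exact iInter_subset _ k
    · exact (emb_mem_horoSphere _ _ _).2 (le_antisymm (hx k) hk)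

lemma facet_eq_image {B : Set (EuclideanSpace ℝ (Fin (n + 1)))}
    {g : EuclideanSpace ℝ (Fin (n + 1))}
    {A : EuclideanSpace ℝ (Fin n) →ₗᵢ[ℝ] EuclideanSpace ℝ (Fin (n + 1))} (h : IsFrame g A) :
    facet n (emb '' B) g.ofLp = (fun z => emb (chart g A (suppFn n (emb '' B) g.ofLp) z)) ''
      (chart g A (suppFn n (emb '' B) g.ofLp) ⁻¹' B) := by
  ext X
  constructor
  · rintro ⟨⟨x, hx, rfl⟩, hX⟩
    obtain ⟨z, hz⟩ := exists_chart_eq h ((emb_mem_horoSphere _ _ _).1 hX)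
    exact ⟨z, by rwa [mem_preimage, hz], by simp only [hz]⟩
  · rintro ⟨z, hz, rfl⟩
    exact ⟨mem_image_of_mem _ hz,
      (emb_mem_horoSphere _ _ _).2 (horo_chart_self h.norm_eq h.inner_eq _ _)⟩

/-- The area of a facet is a constant multiple of its Lebesgue measure in a chart. -/
lemma exists_areaFacet_eq (n : ℕ) [NeZero n] : ∃ c : ℝ, 0 < c ∧
    ∀ (B : Set (EuclideanSpace ℝ (Fin (n + 1)))) (g : EuclideanSpace ℝ (Fin (n + 1)))
      (A : EuclideanSpace ℝ (Fin n) →ₗᵢ[ℝ] EuclideanSpace ℝ (Fin (n + 1))), IsFrame g A →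
      areaFacet n (emb '' B) g.ofLp
        = c * (volume (chart g A (suppFn n (emb '' B) g.ofLp) ⁻¹' B)).toReal := by
  obtain ⟨c, hc0, hc, h⟩ := exists_hausdorffMeasure_eq n
  have hball : 0 < unitBallVol n :=
    ENNReal.toReal_pos (Metric.measure_ball_pos _ _ one_pos).ne' measure_ball_lt_top.ne
  refine ⟨unitBallVol n / 2 ^ n * c.toReal,
    mul_pos (by positivity) (ENNReal.toReal_pos hc0 hc), fun B g A hA => ?_⟩
  rw [areaFacet, facet_eq_image hA,
    hMeasWith_image (dH_emb_chart hA.norm_eq hA.inner_eq _) (NeZero.ne n), h, ENNReal.toReal_mul,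
    ENNReal.toReal_mul, ENNReal.toReal_ofReal (by positivity), mul_assoc]

lemma chart_preimage_body {A : ι → EuclideanSpace ℝ (Fin n) →ₗᵢ[ℝ] EuclideanSpace ℝ (Fin (n + 1))}
    {k : ι} (hA : IsFrame (f k) (A k)) : chart (f k) (A k) (w k) ⁻¹' body f w = slice f A k w := by
  ext z
  refine ⟨fun h l => h l, fun h l => ?_⟩
  rcases eq_or_ne l k with rfl | hl
  · exact (horo_chart_self hA.norm_eq hA.inner_eq _ _).le
  · exact h ⟨l, hl⟩

/-- The intersection of a polytope with a supporting horosphere which is not one of its bounding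
horospheres is a null set. -/
lemma volume_chart_preimage_body_eq_zero [NeZero n] [Finite ι] [Nonempty ι]
    (hf : ∀ k, ‖f k‖ = 1) (hneg : ∀ k, ∃ l, f l = -f k) {g : EuclideanSpace ℝ (Fin (n + 1))}
    (hg : ∀ k, f k ≠ g) {A : EuclideanSpace ℝ (Fin n) →ₗᵢ[ℝ] EuclideanSpace ℝ (Fin (n + 1))}
    (hA : IsFrame g A) :
    volume (chart g A (suppFn n (emb '' body f w) g.ofLp) ⁻¹' body f w) = 0 := by
  set s := suppFn n (emb '' body f w) g.ofLp with hs
  refine measure_mono_null (t := ⋃ k, {z | horo (f k) (chart g A s z) = exp (w k)}) ?_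
    (measure_iUnion_null fun k =>
      volume_horo_chart_eq hA.norm_eq hA.inner_eq (hf k) (hg k) s _)
  intro z hz
  by_contra hcon
  simp only [mem_iUnion, mem_ofPred_eq, not_exists] at hcon
  have hev : ∀ᶠ r in 𝓝 s, ∀ k, horo (f k) (chart g A r z) < exp (w k) :=
    eventually_all.2 fun k => by
      have h1 : Continuous fun r => chart g A r z := by unfold chart; fun_prop
      exact ((continuous_horo (f k)).comp h1).continuousAt.eventually
        (gt_mem_nhds (lt_of_le_of_ne (hz k) (hcon k)))
  obtain ⟨r, hr, hsr⟩ := ((hev.filter_mono nhdsWithin_le_nhds).and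
    (self_mem_nhdsWithin (s := Ioi s))).exists
  have hle : Real.log (horo g (chart g A r z)) ≤ s := by
    rw [hs, suppFn_image_emb]
    exact le_csSup (bddAbove_log_horo hneg hA.norm_eq) ⟨_, fun k => (hr k).le, rfl⟩
  rw [horo_chart_self hA.norm_eq hA.inner_eq, Real.log_exp] at hle
  exact hle.not_gt hsr

end Polytope

/-- **Discrete horospherical p-Minkowski problem, even case.**
Given `p ∈ ℝ` and an even discrete measure `μ = Σ a_i δ_{e_i}` on 𝕊^n (given here by the
`m` pairwise distinct, pairwise non-antipodal unit vectors `e i` together with their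
antipodes `-e i`, with equal positive weights `a i` on `e i` and `-e i`), there exist an
origin-symmetric h-convex polytope `P` containing `O` in its interior whose facets have
precisely the horospherical normals `±e i`, and a constant `λ > 0`, with
`a i = λ · e^{−p·u(P,±e i)} · S(P,±e i)` for all `i`. -/
theorem discrete_horospherical_pMinkowski
    (n m : ℕ) (hn : 1 ≤ n) (hm : 1 ≤ m) (p : ℝ)
    (e : Fin m → (Fin (n + 1) → ℝ)) (he : ∀ i, e i ∈ sph n)
    (hinj : Function.Injective e) (hanti : ∀ i j, e i ≠ -(e j))
    (a : Fin m → ℝ) (ha : ∀ i, 0 < a i) :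
    ∃ P : Set (Fin (n + 2) → ℝ), IsHConvexBody n P ∧
      symMap n '' P = P ∧
      origin n ∈ relInt n P ∧
      P = ⋂ i : Fin m, (horoBallCl n (e i) (suppFn n P (e i)) ∩
            horoBallCl n (-(e i)) (suppFn n P (-(e i)))) ∧
      (∀ i : Fin m, 0 < areaFacet n P (e i) ∧ 0 < areaFacet n P (-(e i))) ∧
      (∀ f ∈ sph n, 0 < areaFacet n P f → ∃ i : Fin m, f = e i ∨ f = -(e i)) ∧
      ∃ lam : ℝ, 0 < lam ∧ ∀ i : Fin m,
        a i = lam * Real.exp (-p * suppFn n P (e i)) * areaFacet n P (e i) ∧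
        a i = lam * Real.exp (-p * suppFn n P (-(e i))) * areaFacet n P (-(e i)) := by
  have : NeZero n := ⟨by lia⟩
  have : NeZero m := ⟨by lia⟩
  set E : Fin m → EuclideanSpace ℝ (Fin (n + 1)) := fun i => WithLp.toLp 2 (e i) with hE
  set f : Fin m ⊕ Fin m → EuclideanSpace ℝ (Fin (n + 1)) := Sum.elim E fun i => -E i with hf
  have hfinj : Function.Injective f := by
    refine Function.Injective.sumElim (fun i j h => hinj ?_) (fun i j h => hinj ?_)
      fun i j h => hanti i j ?_
    · exact congrArg WithLp.ofLp h
    · exact congrArg WithLp.ofLp (neg_injective h)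
    · exact congrArg WithLp.ofLp h
  have hneg : ∀ k, ∃ l, f l = -f k := by
    rintro (i | i)
    · exact ⟨Sum.inr i, rfl⟩
    · exact ⟨Sum.inl i, (neg_neg _).symm⟩
  obtain ⟨A, v, c, hc, hv, hA, hS⟩ :=
    exists_symmetric_body p (fun i => (mem_sph_iff _).1 (he i)) hfinj ha
  obtain ⟨κ, hκ, harea⟩ := exists_areaFacet_eq n
  set w : Fin m ⊕ Fin m → ℝ := Sum.elim v v with hw
  have hfn : ∀ k, ‖f k‖ = 1 := fun k => (hA k).norm_eq
  have hwpos : ∀ k, 0 < w k := by rintro (i | i) <;> exact hv i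
  have hapos : ∀ k, 0 < Sum.elim a a k := by rintro (i | i) <;> exact ha i
  have hsupp : ∀ k, suppFn n (emb '' body f w) (f k).ofLp = w k := by
    intro k
    have h1 : 0 < sliceVol f A k w := by
      rw [hS]; exact mul_pos hc (mul_pos (hapos k) (exp_pos _))
    obtain ⟨z, hz⟩ : (slice f A k w).Nonempty := by
      refine nonempty_iff_ne_empty.2 fun h => ?_
      rw [sliceVol, h, measure_empty] at h1
      exact h1.false
    rw [← chart_preimage_body (hA k)] at hz
    exact suppFn_eq (hfn k) hz (horo_chart_self (hfn k) (hA k).inner_eq _ _)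
  have hfacet : ∀ k, areaFacet n (emb '' body f w) (f k).ofLp
      = κ * (c * (Sum.elim a a k * exp (p * w k))) := by
    intro k
    rw [harea _ _ _ (hA k), hsupp, chart_preimage_body (hA k), ← hS, sliceVol]
  have hfacet_pos : ∀ k, 0 < areaFacet n (emb '' body f w) (f k).ofLp := fun k => by
    rw [hfacet]
    exact mul_pos hκ (mul_pos hc (mul_pos (hapos k) (exp_pos _)))
  have hweight : ∀ k, Sum.elim a a k
      = 1 / (κ * c) * exp (-p * suppFn n (emb '' body f w) (f k).ofLp)
        * areaFacet n (emb '' body f w) (f k).ofLp := by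
    intro k
    rw [hfacet, hsupp, neg_mul, exp_neg]
    field_simp
  refine ⟨emb '' body f w, isHConvexBody_image_body hfn hneg hwpos, ?_,
    origin_mem_relInt hfn hwpos, ?_, fun i => ⟨hfacet_pos (Sum.inl i), hfacet_pos (Sum.inr i)⟩,
    ?_, 1 / (κ * c), by positivity, fun i => ⟨hweight (Sum.inl i), hweight (Sum.inr i)⟩⟩
  · have hsub : ∀ x ∈ body f w, -x ∈ body f w := by
      rintro x hx (i | i)
      · have := hx (Sum.inr i)
        rwa [← horo_neg_neg, show f (Sum.inr i) = -f (Sum.inl i) from rfl, neg_neg] at this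
      · have := hx (Sum.inl i)
        rwa [← horo_neg_neg] at this
    ext X
    constructor
    · rintro ⟨_, ⟨x, hx, rfl⟩, rfl⟩
      exact ⟨-x, hsub x hx, (symMap_emb x).symm⟩
    · rintro ⟨x, hx, rfl⟩
      exact ⟨_, ⟨-x, hsub x hx, rfl⟩, by rw [symMap_emb, neg_neg]⟩
  · conv_lhs => rw [emb_image_body hfn, iInter_sum, ← iInter_inter_distrib]
    refine iInter_congr fun i => ?_
    rw [← hsupp (Sum.inl i), ← hsupp (Sum.inr i)]
    rfl
  · intro g hg hpos
    by_contra! hne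
    obtain ⟨B, hB⟩ := exists_isFrame ((mem_sph_iff g).1 hg)
    have h0 := volume_chart_preimage_body_eq_zero (w := w) hfn hneg (fun k h => by
      rcases k with i | i
      · exact (hne i).1 (congrArg WithLp.ofLp h).symm
      · exact (hne i).2 (congrArg WithLp.ofLp h).symm) hB
    have h1 := harea (body f w) _ _ hB
    rw [h0, ENNReal.toReal_zero, mul_zero] at h1
    exact hpos.ne' h1

end Horo
end
end

section
/- Let K be a h-convex body in ℍ^{n+1} and let ε > 0. Then the horospherical support function of the outer parallel set K^ε satisfies u(K^ε, e) = u(K, e) + ε for every e ∈ 𝕊^n. -/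
noncomputable section

open Real MeasureTheory Filter Topology Set
open scoped ENNReal symmDiff

namespace Horo

theorem lprod_comm (n : ℕ) (X Y : Fin (n + 2) → ℝ) : lprod n X Y = lprod n Y X := by
  simp only [lprod, mul_comm]

theorem lprod_lincomb_left (n : ℕ) (a b : ℝ) (X Y Z : Fin (n + 2) → ℝ) :
    lprod n (a • X + b • Y) Z = a * lprod n X Z + b * lprod n Y Z := by
  simp only [lprod, Pi.add_apply, Pi.smul_apply, smul_eq_mul, add_mul, Finset.sum_add_distrib,
    mul_assoc, ← Finset.mul_sum]
  ring

theorem lprod_lincomb_self (n : ℕ) (a b : ℝ) (X Y : Fin (n + 2) → ℝ) :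
    lprod n (a • X + b • Y) (a • X + b • Y) =
      a ^ 2 * lprod n X X + 2 * a * b * lprod n X Y + b ^ 2 * lprod n Y Y := by
  rw [lprod_lincomb_left, lprod_comm n X, lprod_comm n Y, lprod_lincomb_left, lprod_lincomb_left,
    lprod_comm n Y X]
  ring

theorem lprod_dir (n : ℕ) (X : Fin (n + 2) → ℝ) (e : Fin (n + 1) → ℝ) :
    lprod n X (dir e) = (∑ i : Fin (n + 1), X i.castSucc * e i) - X (Fin.last (n + 1)) := by
  simp [lprod, dir]

theorem lprod_dir_self (n : ℕ) {e : Fin (n + 1) → ℝ} (he : e ∈ sph n) :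
    lprod n (dir e) (dir e) = 0 := by
  have h : ∑ i, e i ^ 2 = 1 := he
  rw [lprod_dir]
  simp [dir, ← pow_two, h]

theorem sq_sum_mul_le (n : ℕ) (X : Fin (n + 2) → ℝ) {e : Fin (n + 1) → ℝ} (he : e ∈ sph n) :
    (∑ i : Fin (n + 1), X i.castSucc * e i) ^ 2 ≤
      lprod n X X + X (Fin.last (n + 1)) ^ 2 := by
  have h : ∑ i, e i ^ 2 = 1 := he
  have hcs := Finset.sum_mul_sq_le_sq_mul_sq Finset.univ (fun i : Fin (n + 1) => X i.castSucc) e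
  rw [h, mul_one] at hcs
  simpa [lprod, ← pow_two] using hcs

theorem lprod_self_nonneg_of_lprod_dir_eq_zero (n : ℕ) {X : Fin (n + 2) → ℝ}
    {e : Fin (n + 1) → ℝ} (he : e ∈ sph n) (hX : lprod n X (dir e) = 0) :
    0 ≤ lprod n X X := by
  have h := sq_sum_mul_le n X he
  rw [lprod_dir, sub_eq_zero] at hX
  rw [hX] at h
  linarith

theorem lprod_dir_neg (n : ℕ) {X : Fin (n + 2) → ℝ} (hX : X ∈ Hyp n)
    {e : Fin (n + 1) → ℝ} (he : e ∈ sph n) : lprod n X (dir e) < 0 := by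
  have h := sq_sum_mul_le n X he
  rw [hX.1] at h
  rw [lprod_dir, sub_neg]
  exact lt_of_pow_lt_pow_left₀ 2 hX.2.le (by linarith)

theorem mem_Hyp_of_lprod_dir_neg (n : ℕ) {X : Fin (n + 2) → ℝ} (hX : lprod n X X = -1)
    {e : Fin (n + 1) → ℝ} (he : e ∈ sph n) (hXe : lprod n X (dir e) < 0) : X ∈ Hyp n := by
  refine ⟨hX, ?_⟩
  have h := sq_sum_mul_le n X he
  rw [hX] at h
  rw [lprod_dir] at hXe
  by_contra! h0
  nlinarith

/-- The function `X ↦ log (-X·(e,1))` is 1-Lipschitz for the hyperbolic distance. -/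
theorem log_neg_lprod_dir_le_add_dH (n : ℕ) {X Y : Fin (n + 2) → ℝ} (hX : X ∈ Hyp n)
    (hY : Y ∈ Hyp n) {e : Fin (n + 1) → ℝ} (he : e ∈ sph n) :
    Real.log (-(lprod n X (dir e))) ≤ Real.log (-(lprod n Y (dir e))) + dH n Y X := by
  have ha := lprod_dir_neg n hX he
  have hb := lprod_dir_neg n hY he
  have hZ : 0 ≤ lprod n _ _ := lprod_self_nonneg_of_lprod_dir_eq_zero n
    (X := lprod n Y (dir e) • X + (-lprod n X (dir e)) • Y) he
    (by rw [lprod_lincomb_left]; ring)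
  rw [lprod_lincomb_self, hX.1, hY.1, lprod_comm n X Y] at hZ
  unfold dH
  set a := -lprod n X (dir e) with ha'
  set b := -lprod n Y (dir e) with hb'
  set c := lprod n Y X
  rw [show lprod n Y (dir e) = -b by rw [hb', neg_neg]] at hZ hb
  have ha0 : 0 < a := by linarith
  have hb0 : 0 < b := by linarith
  have ht : 0 < a / b := by positivity
  have hab : a = a / b * b := by field_simp
  set t := a / b
  have hquad : t ^ 2 + 2 * c * t + 1 ≤ 0 := by
    rw [hab] at hZ
    have : 0 ≤ b ^ 2 * -(t ^ 2 + 2 * c * t + 1) := by linarith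
    linarith [nonneg_of_mul_nonneg_right this (by positivity)]
  have hle : t ≤ -c + √(c ^ 2 - 1) := by
    have := Real.le_sqrt_of_sq_le (x := t + c) (y := c ^ 2 - 1) (by linarith)
    linarith
  rw [hab, Real.log_mul ht.ne' hb0.ne', add_comm]
  gcongr

/-- Moving `Y` a distance `ε` along the geodesic away from the ideal point `e` multiplies
`Y·(e,1)` by `exp ε`. -/
theorem exists_dH_eq_and_lprod_dir_eq (n : ℕ) {Y : Fin (n + 2) → ℝ} (hY : Y ∈ Hyp n)
    {e : Fin (n + 1) → ℝ} (he : e ∈ sph n) {ε : ℝ} (hε : 0 ≤ ε) :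
    ∃ X ∈ Hyp n, dH n Y X = ε ∧ lprod n X (dir e) = Real.exp ε * lprod n Y (dir e) := by
  have hb := lprod_dir_neg n hY he
  set l := lprod n Y (dir e) with hl
  have hexp := Real.exp_pos ε
  let β := (Real.exp ε ^ 2 - 1) / (2 * Real.exp ε * l)
  have hβ : 2 * Real.exp ε * β * l = Real.exp ε ^ 2 - 1 := by
    have hl0 := hb.ne
    simp only [β]
    field_simp
  have hXe : lprod n (Real.exp ε • Y + β • dir e) (dir e) = Real.exp ε * l := by
    rw [lprod_lincomb_left, lprod_dir_self n he, ← hl]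
    ring
  have hYX : lprod n Y (Real.exp ε • Y + β • dir e) = -Real.cosh ε := by
    rw [lprod_comm, lprod_lincomb_left, lprod_comm n (dir e), ← hl, hY.1, Real.cosh_eq,
      Real.exp_neg]
    field_simp
    linarith
  refine ⟨_, mem_Hyp_of_lprod_dir_neg n ?_ he ?_, ?_, hXe⟩
  · rw [lprod_lincomb_self, lprod_dir_self n he, hY.1, ← hl]
    linarith
  · rw [hXe]
    exact mul_neg_of_pos_of_neg hexp hb
  · rw [dH, hYX, neg_neg, neg_sq, Real.cosh_sq, add_sub_cancel_right,
      Real.sqrt_sq (Real.sinh_nonneg_iff.2 hε), Real.cosh_add_sinh, Real.log_exp]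

theorem dH_self (n : ℕ) {X : Fin (n + 2) → ℝ} (hX : X ∈ Hyp n) : dH n X X = 0 := by
  simp [dH, hX.1]

theorem IsHConvexBody.nonempty {n : ℕ} {K : Set (Fin (n + 2) → ℝ)} (hK : IsHConvexBody n K) :
    K.Nonempty := by
  obtain ⟨X, hX, δ, hδ, h⟩ := hK.2.2
  exact ⟨X, h X hX (by rwa [dH_self n hX])⟩

theorem bddAbove_log_neg_lprod_dir (n : ℕ) {K : Set (Fin (n + 2) → ℝ)} (hK : IsHConvexBody n K)
    {e : Fin (n + 1) → ℝ} (he : e ∈ sph n) :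
    BddAbove ((fun X => Real.log (-(lprod n X (dir e)))) '' K) := by
  refine hK.2.1.bddAbove_image (ContinuousOn.log ?_ fun X hX =>
    (neg_pos.2 (lprod_dir_neg n (hK.1.1 hX) he)).ne')
  unfold lprod
  fun_prop

/-- The horospherical support function of the outer parallel set `K^ε` of a h-convex
body `K` satisfies `u(K^ε, e) = u(K, e) + ε` for every `e ∈ 𝕊^n`. -/
theorem suppFn_outerParallel (n : ℕ) (hn : 1 ≤ n)
    (K : Set (Fin (n + 2) → ℝ)) (hK : IsHConvexBody n K)
    (ε : ℝ) (hε : 0 < ε) (e : Fin (n + 1) → ℝ) (he : e ∈ sph n) :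
    suppFn n (outPar n K ε) e = suppFn n K e + ε := by
  have hKb := bddAbove_log_neg_lprod_dir n hK he
  have hub : ∀ y ∈ (fun X => Real.log (-(lprod n X (dir e)))) '' outPar n K ε,
      y ≤ suppFn n K e + ε := by
    rintro _ ⟨X, ⟨hX, Y, hY, hYX⟩, rfl⟩
    have h := log_neg_lprod_dir_le_add_dH n hX (hK.1.1 hY) he
    have h' : _ ≤ suppFn n K e := le_csSup hKb (mem_image_of_mem _ hY)
    exact h.trans (add_le_add h' hYX)
  have hlb : ∀ Y ∈ K, ∃ X ∈ outPar n K ε,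
      Real.log (-(lprod n X (dir e))) = Real.log (-(lprod n Y (dir e))) + ε := by
    intro Y hY
    obtain ⟨X, hX, hd, hXe⟩ := exists_dH_eq_and_lprod_dir_eq n (hK.1.1 hY) he hε.le
    refine ⟨X, ⟨hX, Y, hY, hd.le⟩, ?_⟩
    rw [hXe, ← mul_neg, Real.log_mul (Real.exp_pos ε).ne'
      (neg_pos.2 (lprod_dir_neg n (hK.1.1 hY) he)).ne', Real.log_exp, add_comm]
  obtain ⟨Y₀, hY₀⟩ := hK.nonempty
  obtain ⟨X₀, hX₀, -⟩ := hlb Y₀ hY₀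
  refine le_antisymm (csSup_le ⟨_, mem_image_of_mem _ hX₀⟩ hub) ?_
  rw [← le_sub_iff_add_le]
  refine csSup_le ⟨_, mem_image_of_mem _ hY₀⟩ ?_
  rintro _ ⟨Y, hY, rfl⟩
  obtain ⟨X, hX, hXY⟩ := hlb Y hY
  rw [le_sub_iff_add_le]
  exact hXY.symm.trans_le (le_csSup ⟨_, hub⟩ (mem_image_of_mem _ hX))

end Horo
end
end
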